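/- In F(3), the following orbit-closure equalities hold (closures taken in F(3)): closure(O(H₁)) = O(F₁) ∪ O(H₁); closure(O(H₃)) = O(F₁) ∪ O(H₃); closure(O(H₅)) = O(F₁) ∪ O(H₅); closure(O(H₂)) = O(F₂) ∪ O(H₂); closure(O(H₈)) = O(F₂) ∪ O(H₈); closure(O(F₄)) = O(F₁) ∪ O(F₂) ∪ O(F₄), where these foliations are given in the affine chart z = 1 by: H₁: y³dx − x³dy; H₂: x³dx − y³dy; H₃: y²(3x+y)dx − x²(x+3y)dy; H₅: 2y³dx + x²(3y−2x)dy; H₈: x(x²−3y²)dx − 4y³dy; F₁: y³dx + x³(x dy − y dx); F₂: x³dx + y³(x dy − y dx); F₄: (x³+y³)dx + x³(x dy − y dx). -/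

import Mathlib

open MvPolynomial

noncomputable section

/-- Substitution of the linear change of variables on `ℂ³` given by the matrix `M`. -/
def subst3 (M : Matrix (Fin 3) (Fin 3) ℂ) (P : MvPolynomial (Fin 3) ℂ) :
    MvPolynomial (Fin 3) ℂ :=
  aeval (fun i => ∑ j, C (M i j) * X j) P

/-- Pullback of the 1-form with coefficient vector `Ω` by the linear map of matrix `M`. -/
def pb3 (M : Matrix (Fin 3) (Fin 3) ℂ) (Ω : Fin 3 → MvPolynomial (Fin 3) ℂ) :
    Fin 3 → MvPolynomial (Fin 3) ℂ :=
  fun i => ∑ j, C (M j i) * subst3 M (Ω j)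

/-- Two foliations (given by their projective 1-forms) are linearly conjugate:
`T*Ω = c·Ω'` for some `T ∈ GL₃(ℂ)` and `c ∈ ℂ*`. -/
def LinConj3 (Ω Ω' : Fin 3 → MvPolynomial (Fin 3) ℂ) : Prop :=
  ∃ (M : Matrix (Fin 3) (Fin 3) ℂ) (c : ℂ), IsUnit M.det ∧ c ≠ 0 ∧
    pb3 M Ω = fun i => C c * Ω' i

/-- The orbit of the 1-form `Ω` under pullback by `GL₃(ℂ)` and nonzero rescaling
(the cone over the `PGL₃(ℂ)`-orbit of the corresponding foliation). -/
def OrbitOf (Ω : Fin 3 → MvPolynomial (Fin 3) ℂ) :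
    Set (Fin 3 → MvPolynomial (Fin 3) ℂ) :=
  {Ω' | LinConj3 Ω Ω'}

/-- `Ω` defines a degree-`d` foliation of `ℙ²(ℂ)`: it is a nonzero 1-form with
homogeneous coefficients of degree `d + 1` annihilating the radial vector field and
with no common factor. -/
def IsFolDeg (d : ℕ) (Ω : Fin 3 → MvPolynomial (Fin 3) ℂ) : Prop :=
  Ω ≠ 0 ∧ (∀ i, (Ω i).IsHomogeneous (d + 1)) ∧
    X 0 * Ω 0 + X 1 * Ω 1 + X 2 * Ω 2 = 0 ∧
    ∀ h : MvPolynomial (Fin 3) ℂ, (∀ i, h ∣ Ω i) → IsUnit h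

/-- The coefficient vector of a triple of polynomials. -/
def coeffs (Ω : Fin 3 → MvPolynomial (Fin 3) ℂ) : Fin 3 → (Fin 3 →₀ ℕ) → ℂ :=
  fun i m => coeff m (Ω i)

/-- Closure, inside the space `F(d)` of degree-`d` foliations with its classical
topology (read off on the coefficients), of a set of defining 1-forms. -/
def FClos (d : ℕ) (S : Set (Fin 3 → MvPolynomial (Fin 3) ℂ)) :
    Set (Fin 3 → MvPolynomial (Fin 3) ℂ) :=
  {Ω' | IsFolDeg d Ω' ∧ coeffs Ω' ∈ closure (coeffs '' S)}

/-- `√3` as a complex number. -/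
def s3 : ℂ := (Real.sqrt 3 : ℝ)

/-- Projective 1-form of `H₁ : y³dx − x³dy`. -/
def OmH1 : Fin 3 → MvPolynomial (Fin 3) ℂ :=
  ![X 2 * X 1 ^ 3, -(X 2 * X 0 ^ 3), X 0 ^ 3 * X 1 - X 0 * X 1 ^ 3]

/-- Projective 1-form of `H₂ : x³dx − y³dy`. -/
def OmH2 : Fin 3 → MvPolynomial (Fin 3) ℂ :=
  ![X 2 * X 0 ^ 3, -(X 2 * X 1 ^ 3), X 1 ^ 4 - X 0 ^ 4]

/-- Projective 1-form of `H₃ : y²(3x+y)dx − x²(x+3y)dy`. -/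
def OmH3 : Fin 3 → MvPolynomial (Fin 3) ℂ :=
  ![X 2 * (3 * X 0 * X 1 ^ 2 + X 1 ^ 3), -(X 2 * (X 0 ^ 3 + 3 * X 0 ^ 2 * X 1)),
    X 0 ^ 3 * X 1 - X 0 * X 1 ^ 3]

/-- Projective 1-form of `H₄ : y²(3x+y)dx + x²(x+3y)dy`. -/
def OmH4 : Fin 3 → MvPolynomial (Fin 3) ℂ :=
  ![X 2 * (3 * X 0 * X 1 ^ 2 + X 1 ^ 3), X 2 * (X 0 ^ 3 + 3 * X 0 ^ 2 * X 1),
    -(X 0 ^ 3 * X 1 + 6 * X 0 ^ 2 * X 1 ^ 2 + X 0 * X 1 ^ 3)]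

/-- Projective 1-form of `H₅ : 2y³dx + x²(3y−2x)dy`. -/
def OmH5 : Fin 3 → MvPolynomial (Fin 3) ℂ :=
  ![2 * X 2 * X 1 ^ 3, X 2 * (3 * X 0 ^ 2 * X 1 - 2 * X 0 ^ 3),
    -(2 * X 0 * X 1 ^ 3 + 3 * X 0 ^ 2 * X 1 ^ 2 - 2 * X 0 ^ 3 * X 1)]

/-- Projective 1-form of `H₆ : (4x³−6x²y+4y³)dx + x²(3y−2x)dy`. -/
def OmH6 : Fin 3 → MvPolynomial (Fin 3) ℂ :=
  ![X 2 * (4 * X 0 ^ 3 - 6 * X 0 ^ 2 * X 1 + 4 * X 1 ^ 3),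
    X 2 * (3 * X 0 ^ 2 * X 1 - 2 * X 0 ^ 3),
    -(4 * X 0 ^ 4 - 8 * X 0 ^ 3 * X 1 + 3 * X 0 ^ 2 * X 1 ^ 2 + 4 * X 0 * X 1 ^ 3)]

/-- Projective 1-form of `H₇ : y³dx + x(3y²−x²)dy`. -/
def OmH7 : Fin 3 → MvPolynomial (Fin 3) ℂ :=
  ![X 2 * X 1 ^ 3, X 2 * (3 * X 0 * X 1 ^ 2 - X 0 ^ 3),
    X 0 ^ 3 * X 1 - 4 * X 0 * X 1 ^ 3]

/-- Projective 1-form of `H₈ : x(x²−3y²)dx − 4y³dy`. -/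
def OmH8 : Fin 3 → MvPolynomial (Fin 3) ℂ :=
  ![X 2 * (X 0 ^ 3 - 3 * X 0 * X 1 ^ 2), -(4 * X 2 * X 1 ^ 3),
    -(X 0 ^ 4 - 3 * X 0 ^ 2 * X 1 ^ 2 - 4 * X 1 ^ 4)]

/-- Projective 1-form of `H₉ : y²((−3+i√3)x+2y)dx + x²((1+i√3)x−2i√3·y)dy`. -/
def OmH9 : Fin 3 → MvPolynomial (Fin 3) ℂ :=
  ![X 2 * (C (-3 + Complex.I * s3) * X 0 * X 1 ^ 2 + 2 * X 1 ^ 3),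
    X 2 * (C (1 + Complex.I * s3) * X 0 ^ 3 - C (2 * (Complex.I * s3)) * X 0 ^ 2 * X 1),
    -(C (1 + Complex.I * s3) * X 0 ^ 3 * X 1 + C (-3 - Complex.I * s3) * X 0 ^ 2 * X 1 ^ 2 +
      2 * X 0 * X 1 ^ 3)]

/-- Projective 1-form of
`H₁₁ : (3x³+3√3x²y+3xy²+√3y³)dx + (√3x³+3x²y+3√3xy²+3y³)dy`. -/
def OmH11 : Fin 3 → MvPolynomial (Fin 3) ℂ :=
  ![X 2 * (3 * X 0 ^ 3 + C (3 * s3) * X 0 ^ 2 * X 1 + 3 * X 0 * X 1 ^ 2 + C s3 * X 1 ^ 3),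
    X 2 * (C s3 * X 0 ^ 3 + 3 * X 0 ^ 2 * X 1 + C (3 * s3) * X 0 * X 1 ^ 2 + 3 * X 1 ^ 3),
    -(3 * X 0 ^ 4 + C (4 * s3) * X 0 ^ 3 * X 1 + 6 * X 0 ^ 2 * X 1 ^ 2 +
      C (4 * s3) * X 0 * X 1 ^ 3 + 3 * X 1 ^ 4)]

/-- Projective 1-form of `F₁ : y³dx + x³(x dy − y dx)`. -/
def OmF1 : Fin 3 → MvPolynomial (Fin 3) ℂ :=
  ![X 2 * X 1 ^ 3 - X 0 ^ 3 * X 1, X 0 ^ 4, -(X 0 * X 1 ^ 3)]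

/-- Projective 1-form of `F₂ : x³dx + y³(x dy − y dx)`. -/
def OmF2 : Fin 3 → MvPolynomial (Fin 3) ℂ :=
  ![X 2 * X 0 ^ 3 - X 1 ^ 4, X 0 * X 1 ^ 3, -(X 0 ^ 4)]

/-- Projective 1-form of the Fermat foliation `F₃ : (x³−x)dy − (y³−y)dx`. -/
def OmF3 : Fin 3 → MvPolynomial (Fin 3) ℂ :=
  ![X 1 * X 2 ^ 3 - X 1 ^ 3 * X 2, X 0 ^ 3 * X 2 - X 0 * X 2 ^ 3,
    X 0 * X 1 ^ 3 - X 0 ^ 3 * X 1]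

/-- Projective 1-form of `F₄ : (x³+y³)dx + x³(x dy − y dx)`. -/
def OmF4 : Fin 3 → MvPolynomial (Fin 3) ℂ :=
  ![X 2 * (X 0 ^ 3 + X 1 ^ 3) - X 0 ^ 3 * X 1, X 0 ^ 4, -(X 0 ^ 4 + X 0 * X 1 ^ 3)]

/-- Projective 1-form of `F₅ : y²(y dx + 2x dy) + x³(x dy − y dx)`. -/
def OmF5 : Fin 3 → MvPolynomial (Fin 3) ℂ :=
  ![X 2 * X 1 ^ 3 - X 0 ^ 3 * X 1, 2 * X 0 * X 1 ^ 2 * X 2 + X 0 ^ 4,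
    -(3 * X 0 * X 1 ^ 3)]


set_option linter.unusedSimpArgs false
open Filter Topology

abbrev PolyC := MvPolynomial (Fin 3) ℂ

lemma subst3_mul_mat (M N : Matrix (Fin 3) (Fin 3) ℂ) (P : PolyC) :
    subst3 (M * N) P = subst3 N (subst3 M P) := by
  have : aeval (R := ℂ) (fun i => ∑ j, C ((M * N) i j) * X j : Fin 3 → PolyC) =
      (aeval (R := ℂ) (fun i => ∑ j, C (N i j) * X j : Fin 3 → PolyC)).comp
        (aeval (R := ℂ) (fun i => ∑ j, C (M i j) * X j : Fin 3 → PolyC)) := by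
    apply MvPolynomial.algHom_ext
    intro i
    rw [AlgHom.comp_apply, aeval_X, aeval_X]
    simp only [map_sum, map_mul, aeval_X, Matrix.mul_apply, aeval_C, algebraMap_eq,
      Fin.sum_univ_three, map_add]
    ring
  exact congrArg (fun g : PolyC →ₐ[ℂ] PolyC => g P) this

lemma subst3_one (P : PolyC) : subst3 1 P = P := by
  unfold subst3
  have : (fun i => ∑ j, C ((1 : Matrix (Fin 3) (Fin 3) ℂ) i j) * X j : Fin 3 → PolyC) = X := by
    funext i
    simp [Matrix.one_apply]
  rw [this]; simp

lemma subst3_mul (M : Matrix (Fin 3) (Fin 3) ℂ) (P Q : PolyC) :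
    subst3 M (P * Q) = subst3 M P * subst3 M Q := by simp [subst3]
lemma subst3_C (M : Matrix (Fin 3) (Fin 3) ℂ) (a : ℂ) :
    subst3 M (C a) = C a := by simp [subst3]
lemma subst3_X (M : Matrix (Fin 3) (Fin 3) ℂ) (i : Fin 3) :
    subst3 M (X i) = ∑ j, C (M i j) * X j := by simp [subst3]
lemma subst3_sum (M : Matrix (Fin 3) (Fin 3) ℂ) (P : Fin 3 → PolyC) :
    subst3 M (∑ i, P i) = ∑ i, subst3 M (P i) := by simp [subst3]

lemma pb3_mul (M N : Matrix (Fin 3) (Fin 3) ℂ) (Ω : Fin 3 → PolyC) :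
    pb3 (M * N) Ω = pb3 N (pb3 M Ω) := by
  funext i
  simp only [pb3, subst3_mul_mat, subst3_sum, subst3_mul, subst3_C, Matrix.mul_apply, map_sum,
    map_mul, Finset.sum_mul, Finset.mul_sum]
  rw [Finset.sum_comm]
  refine Finset.sum_congr rfl fun k _ => Finset.sum_congr rfl fun j _ => ?_
  ring

lemma pb3_one (Ω : Fin 3 → PolyC) : pb3 1 Ω = Ω := by
  funext i
  simp [pb3, subst3_one, Matrix.one_apply]

lemma pb3_smul (M : Matrix (Fin 3) (Fin 3) ℂ) (c : ℂ) (Ω : Fin 3 → PolyC) :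
    pb3 M (fun i => C c * Ω i) = fun i => C c * pb3 M Ω i := by
  funext i
  simp only [pb3, subst3_mul, subst3_C, Finset.mul_sum]
  refine Finset.sum_congr rfl fun k _ => ?_
  ring

lemma linConj3_of (Ω Ω' : Fin 3 → PolyC) (M : Matrix (Fin 3) (Fin 3) ℂ) (l : ℂ)
    (hM : M.det ≠ 0) (hl : l ≠ 0) (h : Ω' = fun i => C l * pb3 M Ω i) : LinConj3 Ω Ω' := by
  refine ⟨M, l⁻¹, isUnit_iff_ne_zero.2 hM, inv_ne_zero hl, ?_⟩
  subst h
  funext i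
  rw [← mul_assoc, ← C_mul, inv_mul_cancel₀ hl]; simp

lemma linConj3_iff (Ω Ω' : Fin 3 → PolyC) : LinConj3 Ω Ω' ↔
    ∃ (M : Matrix (Fin 3) (Fin 3) ℂ) (l : ℂ), M.det ≠ 0 ∧ l ≠ 0 ∧
      Ω' = fun i => C l * pb3 M Ω i := by
  constructor
  · rintro ⟨M, c, hM, hc, h⟩
    refine ⟨M, c⁻¹, hM.ne_zero, inv_ne_zero hc, ?_⟩
    rw [h]
    funext i
    rw [← mul_assoc, ← C_mul, inv_mul_cancel₀ hc]; simp
  · rintro ⟨M, l, hM, hl, h⟩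
    exact linConj3_of _ _ M l hM hl h

lemma LinConj3.trans' {a b c : Fin 3 → PolyC} (h : LinConj3 a b) (h' : LinConj3 b c) :
    LinConj3 a c := by
  rw [linConj3_iff] at *
  obtain ⟨M, l, hM, hl, rfl⟩ := h
  obtain ⟨N, k, hN, hk, rfl⟩ := h'
  refine ⟨M * N, k * l, by simp [hM, hN], mul_ne_zero hk hl, ?_⟩
  rw [pb3_smul, pb3_mul]
  funext i
  simp [mul_assoc]

lemma LinConj3.symm' {a b : Fin 3 → PolyC} (h : LinConj3 a b) : LinConj3 b a := by
  rw [linConj3_iff] at *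
  obtain ⟨M, l, hM, hl, rfl⟩ := h
  refine ⟨M⁻¹, l⁻¹, ?_, inv_ne_zero hl, ?_⟩
  · rw [Matrix.det_nonsing_inv]; simpa using hM
  · rw [pb3_smul, ← pb3_mul, Matrix.mul_nonsing_inv _ (isUnit_iff_ne_zero.2 hM), pb3_one]
    funext i
    rw [← mul_assoc, ← C_mul, inv_mul_cancel₀ hl]; simp

lemma orbit_congr {a b : Fin 3 → PolyC} (h : LinConj3 a b) : OrbitOf a = OrbitOf b := by
  ext c
  exact ⟨fun h' => h.symm'.trans' h', fun h' => h.trans' h'⟩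

lemma subst3_hom (M : Matrix (Fin 3) (Fin 3) ℂ) {P : PolyC} {d : ℕ} (h : P.IsHomogeneous d) :
    (subst3 M P).IsHomogeneous d := by
  have := h.aeval (fun i => ∑ j, C (M i j) * X j : Fin 3 → PolyC) (n := 1) (fun i => by
    apply IsHomogeneous.sum
    intro j _
    simpa using (isHomogeneous_C (Fin 3) (M i j)).mul (isHomogeneous_X ℂ j))
  simpa [subst3] using this

lemma smul_hom (c : ℂ) {P : PolyC} {d : ℕ} (h : P.IsHomogeneous d) :
    (C c * P).IsHomogeneous d := by
  simpa using (isHomogeneous_C (Fin 3) c).mul h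

lemma pb3_hom (M : Matrix (Fin 3) (Fin 3) ℂ) {Ω : Fin 3 → PolyC} {d : ℕ}
    (h : ∀ i, (Ω i).IsHomogeneous d) (i : Fin 3) : (pb3 M Ω i).IsHomogeneous d := by
  apply IsHomogeneous.sum
  intro j _
  exact smul_hom _ (subst3_hom M (h j))

lemma subst3_isUnit (M : Matrix (Fin 3) (Fin 3) ℂ) {P : PolyC} (h : IsUnit P) :
    IsUnit (subst3 M P) := by
  unfold subst3
  exact h.map (aeval (R := ℂ) (fun i => ∑ j, C (M i j) * X j : Fin 3 → PolyC))

lemma subst3_dvd (M : Matrix (Fin 3) (Fin 3) ℂ) {P Q : PolyC} (h : P ∣ Q) :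
    subst3 M P ∣ subst3 M Q := by
  obtain ⟨R, rfl⟩ := h
  rw [subst3_mul]
  exact dvd_mul_right _ _

lemma isFol_pb3 {M : Matrix (Fin 3) (Fin 3) ℂ} (hM : M.det ≠ 0) {Ω : Fin 3 → PolyC} {d : ℕ}
    (h : IsFolDeg d Ω) : IsFolDeg d (pb3 M Ω) := by
  obtain ⟨h0, h1, h2, h3⟩ := h
  have hu := isUnit_iff_ne_zero.2 hM
  have hinv : pb3 M⁻¹ (pb3 M Ω) = Ω := by
    rw [← pb3_mul, Matrix.mul_nonsing_inv _ hu, pb3_one]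
  refine ⟨?_, pb3_hom M h1, ?_, ?_⟩
  · intro h
    apply h0
    rw [← hinv, h]
    funext i
    simp [pb3, subst3]
  · have := congrArg (subst3 M) h2
    simp only [subst3, map_add, map_mul, aeval_X, map_zero, Fin.sum_univ_three] at this
    simp only [pb3, subst3, Fin.sum_univ_three]
    linear_combination this
  · intro h hh
    have : IsUnit (subst3 M⁻¹ h) := by
      apply h3
      intro i
      rw [← hinv]
      apply Finset.dvd_sum
      intro j _
      exact Dvd.dvd.mul_left (subst3_dvd _ (hh j)) _
    have := subst3_isUnit M this
    rwa [← subst3_mul_mat, Matrix.nonsing_inv_mul _ hu, subst3_one] at this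

lemma isFol_smul {l : ℂ} (hl : l ≠ 0) {Ω : Fin 3 → PolyC} {d : ℕ}
    (h : IsFolDeg d Ω) : IsFolDeg d (fun i => C l * Ω i) := by
  obtain ⟨h0, h1, h2, h3⟩ := h
  have e : ∀ i, Ω i = C l⁻¹ * (C l * Ω i) := by
    intro i
    rw [← mul_assoc, ← C_mul, inv_mul_cancel₀ hl]; simp
  refine ⟨?_, fun i => smul_hom _ (h1 i), ?_, ?_⟩
  · intro h
    apply h0
    funext i
    rw [e i, congrFun h i]; simp
  · linear_combination (C l) * h2
  · intro h hh
    apply h3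
    intro i
    rw [e i]
    exact Dvd.dvd.mul_left (hh i) _

lemma isFol_orbit {Ω Ω' : Fin 3 → PolyC} {d : ℕ} (h : IsFolDeg d Ω) (h' : LinConj3 Ω Ω') :
    IsFolDeg d Ω' := by
  rw [linConj3_iff] at h'
  obtain ⟨M, l, hM, hl, rfl⟩ := h'
  exact isFol_smul hl (isFol_pb3 hM h)

/-- coefficientwise convergence -/
def TC {ι : Type} (f : Filter ι) (P : ι → PolyC) (Q : PolyC) : Prop :=
  ∀ m, Tendsto (fun n => coeff m (P n)) f (𝓝 (coeff m Q))

section TC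
variable {ι : Type} {f : Filter ι}

lemma TC.const (Q : PolyC) : TC f (fun _ => Q) Q := fun _ => tendsto_const_nhds
lemma TC.add {P P' : ι → PolyC} {Q Q' : PolyC} (h : TC f P Q) (h' : TC f P' Q') :
    TC f (fun n => P n + P' n) (Q + Q') := by
  intro m; simpa using (h m).add (h' m)
lemma TC.neg {P : ι → PolyC} {Q : PolyC} (h : TC f P Q) :
    TC f (fun n => - P n) (-Q) := by
  intro m; simpa using (h m).neg
lemma TC.sub {P P' : ι → PolyC} {Q Q' : PolyC} (h : TC f P Q) (h' : TC f P' Q') :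
    TC f (fun n => P n - P' n) (Q - Q') := by
  intro m; simpa using (h m).sub (h' m)
lemma TC.mul {P P' : ι → PolyC} {Q Q' : PolyC} (h : TC f P Q) (h' : TC f P' Q') :
    TC f (fun n => P n * P' n) (Q * Q') := by
  intro m
  simp only [coeff_mul]
  exact tendsto_finsetSum _ fun i _ => (h _).mul (h' _)
lemma TC.sum {κ : Type} (s : Finset κ) {P : κ → ι → PolyC} {Q : κ → PolyC}
    (h : ∀ k ∈ s, TC f (P k) (Q k)) :
    TC f (fun n => ∑ k ∈ s, P k n) (∑ k ∈ s, Q k) := by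
  intro m
  simp only [coeff_sum]
  exact tendsto_finsetSum _ fun i hi => h i hi m
lemma TC.pow {P : ι → PolyC} {Q : PolyC} (h : TC f P Q) (k : ℕ) :
    TC f (fun n => P n ^ k) (Q ^ k) := by
  induction k with
  | zero => simpa using TC.const 1
  | succ k ih => simpa [pow_succ] using ih.mul h
lemma TC.C {a : ι → ℂ} {b : ℂ} (h : Tendsto a f (𝓝 b)) :
    TC f (fun n => C (a n)) (C b) := by
  intro m
  simp only [coeff_C]
  split_ifs
  · exact h
  · exact tendsto_const_nhds
lemma TC.unique [f.NeBot] {P : ι → PolyC} {Q Q' : PolyC} (h : TC f P Q) (h' : TC f P Q') : Q = Q' := by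
  ext m
  exact tendsto_nhds_unique (h m) (h' m)

lemma subst3_expand (M : Matrix (Fin 3) (Fin 3) ℂ) {P : PolyC} {d : ℕ} (h : P.IsHomogeneous d) :
    subst3 M P = ∑ k ∈ Finset.finsuppAntidiag Finset.univ d, C (coeff k P) *
      ((∑ j, C (M 0 j) * X j) ^ (k 0) * (∑ j, C (M 1 j) * X j) ^ (k 1) *
        (∑ j, C (M 2 j) * X j) ^ (k 2)) := by
  have : P = ∑ k ∈ Finset.finsuppAntidiag Finset.univ d, monomial k (coeff k P) := by
    conv_lhs => rw [P.as_sum]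
    apply Finset.sum_subset
    · intro k hk
      rw [Finset.mem_finsuppAntidiag]
      refine ⟨?_, by simp⟩
      have := h (mem_support_iff.1 hk)
      rw [← this, Finsupp.weight_apply, Finsupp.sum_fintype _ _ (by simp)]
      simp
    · intro k _ hk
      simp [notMem_support_iff.1 hk]
  conv_lhs => rw [this]
  simp only [subst3, map_sum, aeval_monomial, algebraMap_eq]
  refine Finset.sum_congr rfl fun k _ => ?_
  rw [Finsupp.prod_fintype _ _ (by simp)]
  rw [Fin.prod_univ_three]

lemma TC.subst3 {M : ι → Matrix (Fin 3) (Fin 3) ℂ} {M' : Matrix (Fin 3) (Fin 3) ℂ}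
    {P : ι → PolyC} {Q : PolyC} {d : ℕ}
    (hM : Tendsto M f (𝓝 M')) (h : TC f P Q) (hP : ∀ n, (P n).IsHomogeneous d)
    (hQ : Q.IsHomogeneous d) : TC f (fun n => subst3 (M n) (P n)) (subst3 M' Q) := by
  have e : ∀ i j, Tendsto (fun n => M n i j) f (𝓝 (M' i j)) := fun i j =>
    ((continuous_apply_apply i j).tendsto M').comp hM
  have l : ∀ i, TC f (fun n => ∑ j, MvPolynomial.C (M n i j) * X j)
      (∑ j, MvPolynomial.C (M' i j) * X j) :=
    fun i => TC.sum _ fun j _ => (TC.C (e i j)).mul (TC.const _)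
  rw [subst3_expand M' hQ]
  simp only [fun n => subst3_expand (M n) (hP n)]
  exact TC.sum _ fun k _ => (TC.C (h k)).mul ((((l 0).pow _).mul ((l 1).pow _)).mul ((l 2).pow _))

lemma TC.pb3 {M : ι → Matrix (Fin 3) (Fin 3) ℂ} {M' : Matrix (Fin 3) (Fin 3) ℂ}
    {P : ι → Fin 3 → PolyC} {Q : Fin 3 → PolyC} {d : ℕ}
    (hM : Tendsto M f (𝓝 M')) (h : ∀ i, TC f (fun n => P n i) (Q i))
    (hP : ∀ n i, (P n i).IsHomogeneous d)
    (hQ : ∀ i, (Q i).IsHomogeneous d) (i : Fin 3) :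
    TC f (fun n => pb3 (M n) (P n) i) (pb3 M' Q i) := by
  have e : ∀ i j, Tendsto (fun n => M n i j) f (𝓝 (M' i j)) := fun i j =>
    ((continuous_apply_apply i j).tendsto M').comp hM
  exact TC.sum _ fun j _ => (TC.C (e j i)).mul (TC.subst3 hM (h j) (fun n => hP n j) (hQ j))
end TC

lemma orbit_subset_FClos {Ω : Fin 3 → PolyC} (h : IsFolDeg 3 Ω) : OrbitOf Ω ⊆ FClos 3 (OrbitOf Ω) :=
  fun _ h' => ⟨isFol_orbit h h', subset_closure ⟨_, h', rfl⟩⟩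

lemma orbit_subset_FClos' {Ω Y : Fin 3 → PolyC} (hΩ : IsFolDeg 3 Ω) (hY : IsFolDeg 3 Y)
    (P : ℕ → Fin 3 → PolyC) (hP : ∀ n, P n ∈ OrbitOf Ω) (hl : ∀ i, TC atTop (fun n => P n i) (Y i)) :
    OrbitOf Y ⊆ FClos 3 (OrbitOf Ω) := by
  intro Ω' h'
  refine ⟨isFol_orbit hY h', ?_⟩
  obtain ⟨M, l, hM, hl0, rfl⟩ := (linConj3_iff _ _).1 h'
  have key : ∀ i, TC atTop (fun n => C l * pb3 M (P n) i) (C l * pb3 M Y i) := fun i =>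
    (TC.const _).mul (TC.pb3 tendsto_const_nhds hl (fun n => (isFol_orbit hΩ (hP n)).2.1) hY.2.1 i)
  refine mem_closure_of_tendsto (f := fun n => coeffs (fun i => C l * pb3 M (P n) i)) (b := atTop) ?_ ?_
  · rw [tendsto_pi_nhds]
    intro i
    rw [tendsto_pi_nhds]
    exact fun m => key i m
  · refine Eventually.of_forall fun n => ⟨_, ?_, rfl⟩
    exact (hP n).trans' (linConj3_of _ _ M l hM hl0 rfl)

lemma lq (M : Matrix (Fin 3) (Fin 3) ℂ) : ∃ T U : Matrix (Fin 3) (Fin 3) ℂ,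
    M = T * U ∧ U ∈ Matrix.unitaryGroup (Fin 3) ℂ ∧ T 0 1 = 0 ∧ T 0 2 = 0 ∧ T 1 2 = 0 := by
  let v : Fin 3 → EuclideanSpace ℂ (Fin 3) := fun i => WithLp.toLp 2 (M i)
  have hd : Module.finrank ℂ (EuclideanSpace ℂ (Fin 3)) = Fintype.card (Fin 3) := by simp
  let b := InnerProductSpace.gramSchmidtOrthonormalBasis hd v
  refine ⟨Matrix.of fun i j => inner ℂ (b j) (v i), Matrix.of fun i j => b i j, ?_, ?_, ?_, ?_, ?_⟩
  · ext i j
    have := b.sum_repr' (v i)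
    have := congrArg (fun w : EuclideanSpace ℂ (Fin 3) => w j) this
    simp only [Matrix.mul_apply, Matrix.of_apply]
    simpa [v, Fin.sum_univ_three] using this.symm
  · rw [Matrix.mem_unitaryGroup_iff]
    ext i j
    have := b.inner_eq_ite j i
    rw [Matrix.mul_apply]
    simp only [Matrix.star_apply, Matrix.one_apply, Matrix.of_apply]
    rw [PiLp.inner_apply] at this
    simp only [RCLike.inner_apply] at this
    simp only [eq_comm (a := i)]
    exact this
  all_goals
    exact InnerProductSpace.gramSchmidtOrthonormalBasis_inv_triangular hd v (by decide)

lemma unitary_lim (U : ℕ → Matrix (Fin 3) (Fin 3) ℂ) (hU : ∀ n, U n ∈ Matrix.unitaryGroup (Fin 3) ℂ) :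
    ∃ W ∈ Matrix.unitaryGroup (Fin 3) ℂ, Tendsto U (hyperfilter ℕ) (𝓝 W) := by
  have hc : IsCompact (Set.pi Set.univ (fun _ : Fin 3 => Set.pi Set.univ
      (fun _ : Fin 3 => Metric.closedBall (0:ℂ) 1))) :=
    isCompact_univ_pi fun _ => isCompact_univ_pi fun _ => isCompact_closedBall _ _
  obtain ⟨W, -, hW⟩ := hc.ultrafilter_le_nhds ((hyperfilter ℕ).map U) (by
    rw [le_principal_iff]
    refine Eventually.of_forall (f := (hyperfilter ℕ : Filter ℕ)) fun n => ?_
    intro i _ j _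
    rw [Metric.mem_closedBall, dist_zero_right]
    exact entry_norm_bound_of_unitary (hU n) i j)
  let W : Matrix (Fin 3) (Fin 3) ℂ := Matrix.of W
  have hW' : Tendsto U (hyperfilter ℕ) (𝓝 W) := hW
  refine ⟨W, ?_, hW'⟩
  have hcl : IsClosed {V : Matrix (Fin 3) (Fin 3) ℂ | V * star V = 1} :=
    isClosed_eq (by fun_prop) (by fun_prop)
  rw [Matrix.mem_unitaryGroup_iff]
  exact hcl.mem_of_tendsto hW' (Eventually.of_forall fun n => Matrix.mem_unitaryGroup_iff.1 (hU n))

lemma reduce {Ω Ω' : Fin 3 → PolyC} (hΩ : IsFolDeg 3 Ω) (h : Ω' ∈ FClos 3 (OrbitOf Ω)) :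
    ∃ Y : Fin 3 → PolyC, LinConj3 Y Ω' ∧ IsFolDeg 3 Y ∧
    ∃ (T : ℕ → Matrix (Fin 3) (Fin 3) ℂ) (l : ℕ → ℂ),
      (∀ n, T n 0 1 = 0 ∧ T n 0 2 = 0 ∧ T n 1 2 = 0 ∧ (T n).det ≠ 0 ∧ l n ≠ 0) ∧
      ∀ i, TC (hyperfilter ℕ : Filter ℕ) (fun n => C (l n) * pb3 (T n) Ω i) (Y i) := by
  obtain ⟨hF, hcl⟩ := h
  obtain ⟨y, hy, hlim⟩ := mem_closure_iff_seq_limit.1 hcl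
  choose P hP hPy using hy
  have hP' := fun n => (linConj3_iff _ _).1 (hP n)
  choose M l hM hl hPM using hP'
  choose T U hTU hU h1 h2 h3 using fun n => lq (M n)
  obtain ⟨W, hW, hUW⟩ := unitary_lim U hU
  have hUs : ∀ n, U n * star (U n) = 1 := fun n => Matrix.mem_unitaryGroup_iff.1 (hU n)
  have hWs : W * star W = 1 := Matrix.mem_unitaryGroup_iff.1 hW
  have hWd : (star W).det ≠ 0 := by
    intro h0
    have := congrArg Matrix.det hWs
    simp [h0] at this
  refine ⟨pb3 (star W) Ω', ?_, isFol_pb3 hWd hF, T, l, ?_, ?_⟩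
  · exact LinConj3.symm' (linConj3_of _ _ (star W) 1 hWd one_ne_zero (by simp))
  · refine fun n => ⟨h1 n, h2 n, h3 n, ?_, hl n⟩
    have := hM n
    rw [hTU n, Matrix.det_mul] at this
    exact left_ne_zero_of_mul this
  · have e : ∀ n, (fun i => C (l n) * pb3 (T n) Ω i) = pb3 (star (U n)) (P n) := by
      intro n
      rw [hPM n, pb3_smul, ← pb3_mul]
      conv_rhs => rw [hTU n, mul_assoc, hUs n, mul_one]
    have e' : ∀ n i, C (l n) * pb3 (T n) Ω i = pb3 (star (U n)) (P n) i := fun n i => congrFun (e n) i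
    simp only [e']
    refine TC.pb3 (d := 4) ((continuous_star.tendsto W).comp hUW) ?_
      (fun n => (isFol_orbit hΩ (hP n)).2.1) hF.2.1
    intro i m
    have := (tendsto_pi_nhds.1 ((tendsto_pi_nhds.1 hlim) i) m).mono_left Nat.hyperfilter_le_atTop
    simpa [← hPy, _root_.coeffs] using this

/-- exponent vectors -/
def mono (i j k : ℕ) : Fin 3 →₀ ℕ := Finsupp.equivFunOnFinite.symm ![i, j, k]

lemma mono_inj (i j k i' j' k' : ℕ) : mono i j k = mono i' j' k' ↔ i = i' ∧ j = j' ∧ k = k' := by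
  unfold mono
  rw [Equiv.apply_eq_iff_eq]
  simp

lemma monomial_mono (i j k : ℕ) (a : ℂ) :
    monomial (mono i j k) a = C a * X 0 ^ i * X 1 ^ j * X 2 ^ k := by
  rw [monomial_eq, Finsupp.prod_fintype _ _ (by simp), Fin.prod_univ_three]
  simp [mono, mul_assoc]

/-- The form `z(A dx + B dy) - (xA + yB) dz + P (x dy - y dx)`, with `A, B, P` binary cubics. -/
def mkF (a b p : Fin 4 → ℂ) : Fin 3 → PolyC :=
  ![X 2 * (C (a 0) * X 1 ^ 3 + C (a 1) * X 0 * X 1 ^ 2 + C (a 2) * X 0 ^ 2 * X 1 + C (a 3) * X 0 ^ 3)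
      - X 1 * (C (p 0) * X 1 ^ 3 + C (p 1) * X 0 * X 1 ^ 2 + C (p 2) * X 0 ^ 2 * X 1 + C (p 3) * X 0 ^ 3),
    X 2 * (C (b 0) * X 1 ^ 3 + C (b 1) * X 0 * X 1 ^ 2 + C (b 2) * X 0 ^ 2 * X 1 + C (b 3) * X 0 ^ 3)
      + X 0 * (C (p 0) * X 1 ^ 3 + C (p 1) * X 0 * X 1 ^ 2 + C (p 2) * X 0 ^ 2 * X 1 + C (p 3) * X 0 ^ 3),
    - (X 0 * (C (a 0) * X 1 ^ 3 + C (a 1) * X 0 * X 1 ^ 2 + C (a 2) * X 0 ^ 2 * X 1 + C (a 3) * X 0 ^ 3)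
      + X 1 * (C (b 0) * X 1 ^ 3 + C (b 1) * X 0 * X 1 ^ 2 + C (b 2) * X 0 ^ 2 * X 1 + C (b 3) * X 0 ^ 3))]

lemma mk0 (a b p : Fin 4 → ℂ) : mkF a b p 0 =
    monomial (mono 0 3 1) (a 0) + monomial (mono 1 2 1) (a 1) + monomial (mono 2 1 1) (a 2)
    + monomial (mono 3 0 1) (a 3) - monomial (mono 0 4 0) (p 0) - monomial (mono 1 3 0) (p 1)
    - monomial (mono 2 2 0) (p 2) - monomial (mono 3 1 0) (p 3) := by
  simp only [monomial_mono, mkF, Matrix.cons_val_zero]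
  ring

lemma mk1 (a b p : Fin 4 → ℂ) : mkF a b p 1 =
    monomial (mono 0 3 1) (b 0) + monomial (mono 1 2 1) (b 1) + monomial (mono 2 1 1) (b 2)
    + monomial (mono 3 0 1) (b 3) + monomial (mono 1 3 0) (p 0) + monomial (mono 2 2 0) (p 1)
    + monomial (mono 3 1 0) (p 2) + monomial (mono 4 0 0) (p 3) := by
  simp only [monomial_mono, mkF, Matrix.cons_val_one, Matrix.cons_val_zero]
  ring

lemma coeff_a (a b p : Fin 4 → ℂ) :
    coeff (mono 0 3 1) (mkF a b p 0) = a 0 ∧ coeff (mono 1 2 1) (mkF a b p 0) = a 1 ∧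
    coeff (mono 2 1 1) (mkF a b p 0) = a 2 ∧ coeff (mono 3 0 1) (mkF a b p 0) = a 3 ∧
    coeff (mono 0 3 1) (mkF a b p 1) = b 0 ∧ coeff (mono 1 2 1) (mkF a b p 1) = b 1 ∧
    coeff (mono 2 1 1) (mkF a b p 1) = b 2 ∧ coeff (mono 3 0 1) (mkF a b p 1) = b 3 ∧
    coeff (mono 1 3 0) (mkF a b p 1) = p 0 ∧ coeff (mono 2 2 0) (mkF a b p 1) = p 1 ∧
    coeff (mono 3 1 0) (mkF a b p 1) = p 2 ∧ coeff (mono 4 0 0) (mkF a b p 1) = p 3 := by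
  simp only [mk0, mk1, coeff_add, coeff_sub, coeff_monomial, mono_inj]
  simp

lemma TC_mk {ι : Type} {f : Filter ι} {a b p : ι → Fin 4 → ℂ} {a' b' p' : Fin 4 → ℂ}
    (ha : ∀ i, Tendsto (fun n => a n i) f (𝓝 (a' i)))
    (hb : ∀ i, Tendsto (fun n => b n i) f (𝓝 (b' i)))
    (hp : ∀ i, Tendsto (fun n => p n i) f (𝓝 (p' i))) (i : Fin 3) :
    TC f (fun n => mkF (a n) (b n) (p n) i) (mkF a' b' p' i) := by
  have cub : ∀ (c : ι → Fin 4 → ℂ) (c' : Fin 4 → ℂ),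
      (∀ i, Tendsto (fun n => c n i) f (𝓝 (c' i))) →
      TC f (fun n => C (c n 0) * X 1 ^ 3 + C (c n 1) * X 0 * X 1 ^ 2 + C (c n 2) * X 0 ^ 2 * X 1
        + C (c n 3) * X 0 ^ 3)
      (C (c' 0) * X 1 ^ 3 + C (c' 1) * X 0 * X 1 ^ 2 + C (c' 2) * X 0 ^ 2 * X 1
        + C (c' 3) * X 0 ^ 3) := by
    intro c c' h
    exact ((((TC.C (h 0)).mul (TC.const _)).add (((TC.C (h 1)).mul (TC.const _)).mul (TC.const _))).add
      (((TC.C (h 2)).mul (TC.const _)).mul (TC.const _))).add ((TC.C (h 3)).mul (TC.const _))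
  fin_cases i
  · exact ((TC.const _).mul (cub a a' ha)).sub ((TC.const _).mul (cub p p' hp))
  · exact ((TC.const _).mul (cub b b' hb)).add ((TC.const _).mul (cub p p' hp))
  · exact (((TC.const _).mul (cub a a' ha)).add ((TC.const _).mul (cub b b' hb))).neg

lemma mk_lim {ι : Type} {f : Filter ι} [f.NeBot] {a b p : ι → Fin 4 → ℂ} {Y : Fin 3 → PolyC}
    (h : ∀ i, TC f (fun n => mkF (a n) (b n) (p n) i) (Y i)) :
    ∃ a' b' p' : Fin 4 → ℂ, Y = mkF a' b' p' ∧
      (∀ i, Tendsto (fun n => a n i) f (𝓝 (a' i))) ∧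
      (∀ i, Tendsto (fun n => b n i) f (𝓝 (b' i))) ∧
      (∀ i, Tendsto (fun n => p n i) f (𝓝 (p' i))) := by
  let a' : Fin 4 → ℂ := ![coeff (mono 0 3 1) (Y 0), coeff (mono 1 2 1) (Y 0),
    coeff (mono 2 1 1) (Y 0), coeff (mono 3 0 1) (Y 0)]
  let b' : Fin 4 → ℂ := ![coeff (mono 0 3 1) (Y 1), coeff (mono 1 2 1) (Y 1),
    coeff (mono 2 1 1) (Y 1), coeff (mono 3 0 1) (Y 1)]
  let p' : Fin 4 → ℂ := ![coeff (mono 1 3 0) (Y 1), coeff (mono 2 2 0) (Y 1),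
    coeff (mono 3 1 0) (Y 1), coeff (mono 4 0 0) (Y 1)]
  have e := fun n => coeff_a (a n) (b n) (p n)
  have ha : ∀ i, Tendsto (fun n => a n i) f (𝓝 (a' i)) := by
    intro i
    fin_cases i
    · exact (h 0 (mono 0 3 1)).congr fun n => (e n).1
    · exact (h 0 (mono 1 2 1)).congr fun n => (e n).2.1
    · exact (h 0 (mono 2 1 1)).congr fun n => (e n).2.2.1
    · exact (h 0 (mono 3 0 1)).congr fun n => (e n).2.2.2.1
  have hb : ∀ i, Tendsto (fun n => b n i) f (𝓝 (b' i)) := by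
    intro i
    fin_cases i
    · exact (h 1 (mono 0 3 1)).congr fun n => (e n).2.2.2.2.1
    · exact (h 1 (mono 1 2 1)).congr fun n => (e n).2.2.2.2.2.1
    · exact (h 1 (mono 2 1 1)).congr fun n => (e n).2.2.2.2.2.2.1
    · exact (h 1 (mono 3 0 1)).congr fun n => (e n).2.2.2.2.2.2.2.1
  have hp : ∀ i, Tendsto (fun n => p n i) f (𝓝 (p' i)) := by
    intro i
    fin_cases i
    · exact (h 1 (mono 1 3 0)).congr fun n => (e n).2.2.2.2.2.2.2.2.1
    · exact (h 1 (mono 2 2 0)).congr fun n => (e n).2.2.2.2.2.2.2.2.2.1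
    · exact (h 1 (mono 3 1 0)).congr fun n => (e n).2.2.2.2.2.2.2.2.2.2.1
    · exact (h 1 (mono 4 0 0)).congr fun n => (e n).2.2.2.2.2.2.2.2.2.2.2
  refine ⟨a', b', p', ?_, ha, hb, hp⟩
  funext i
  exact (h i).unique (TC_mk ha hb hp i)

lemma mk_hom (a b p : Fin 4 → ℂ) (i : Fin 3) : (mkF a b p i).IsHomogeneous 4 := by
  have x : ∀ i : Fin 3, (X i : PolyC).IsHomogeneous 1 := fun i => isHomogeneous_X ℂ i
  have cub : ∀ c : Fin 4 → ℂ, (C (c 0) * X 1 ^ 3 + C (c 1) * X 0 * X 1 ^ 2 +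
      C (c 2) * X 0 ^ 2 * X 1 + C (c 3) * X 0 ^ 3 : PolyC).IsHomogeneous 3 := by
    intro c
    refine ((IsHomogeneous.add ?_ ?_).add ?_).add ?_
    · exact smul_hom _ ((x 1).pow 3)
    · rw [mul_assoc]; exact smul_hom _ ((x 0).mul ((x 1).pow 2))
    · rw [mul_assoc]; exact smul_hom _ (((x 0).pow 2).mul (x 1))
    · exact smul_hom _ ((x 0).pow 3)
  fin_cases i
  · exact ((x 2).mul (cub a)).sub ((x 1).mul (cub p))
  · exact ((x 2).mul (cub b)).add ((x 0).mul (cub p))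
  · exact (((x 0).mul (cub a)).add ((x 1).mul (cub b))).neg

lemma X_not_unit (i : Fin 3) : ¬ IsUnit (X i : PolyC) := by
  intro h
  have := h.map (constantCoeff (R := ℂ) (σ := Fin 3))
  simp at this

/-- common factors vanish nowhere at the origin -/
lemma fol_const {Ω : Fin 3 → PolyC} (h : IsFolDeg 3 Ω) (D : PolyC) (hD : constantCoeff D = 0)
    (hd : ∀ i, D ∣ Ω i) : False := by
  have := (h.2.2.2 D hd).map (constantCoeff (R := ℂ) (σ := Fin 3))
  simp [hD] at this


lemma X_dvd_eval {i : Fin 3} {P : PolyC} (h : X i ∣ P) (v : Fin 3 → ℂ) (hv : v i = 0) :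
    eval v P = 0 := by
  obtain ⟨Q, rfl⟩ := h
  simp [hv]

/-- criterion for `mkF a b p` to be a foliation -/
lemma fol_of (a b p : Fin 4 → ℂ) (k : Fin 3) (c : ℂ) (hc : c ≠ 0)
    (hk : mkF a b p k = C c * X 0 ^ 4 ∨ mkF a b p k = C c * (X 2 * X 0 ^ 3))
    (hx : ∃ j, eval ![0, 1, 1] (mkF a b p j) ≠ 0)
    (hz : mkF a b p k = C c * (X 2 * X 0 ^ 3) → ∃ j x y, eval ![x, y, 0] (mkF a b p j) ≠ 0) :
    IsFolDeg 3 (mkF a b p) := by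
  refine ⟨?_, mk_hom a b p, ?_, ?_⟩
  · intro h
    obtain ⟨j, hj⟩ := hx
    rw [h] at hj
    simp at hj
  · simp only [mkF, Matrix.cons_val_zero, Matrix.cons_val_one, Matrix.cons_val]
    ring
  · intro h hh
    by_contra hu
    have h0 : h ≠ 0 := by
      rintro rfl
      obtain ⟨j, hj⟩ := hx
      have := zero_dvd_iff.1 (hh j)
      rw [this] at hj
      simp at hj
    obtain ⟨q, hq, hqh⟩ := WfDvdMonoid.exists_irreducible_factor hu h0
    have hqp := hq.prime
    have hCu : IsUnit (C c : PolyC) := (isUnit_iff_ne_zero.2 hc).map C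
    have hqk := hqh.trans (hh k)
    have isx : ∀ i : Fin 3, q ∣ X i → ∀ j, X i ∣ mkF a b p j := by
      intro i hi j
      have : Associated q (X i : PolyC) := hq.associated_of_dvd (X_prime (i := i)).irreducible hi
      exact this.symm.dvd.trans (hqh.trans (hh j))
    have case0 : q ∣ X 0 → False := by
      intro h
      obtain ⟨j, hj⟩ := hx
      exact hj (X_dvd_eval (isx 0 h j) _ (by simp))
    rcases hk with hk | hk
    · rw [hk] at hqk
      exact case0 (hqp.dvd_of_dvd_pow ((hCu.dvd_mul_left).1 hqk))
    · obtain ⟨j, x, y, hj⟩ := hz hk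
      rw [hk] at hqk
      rcases hqp.dvd_or_dvd ((hCu.dvd_mul_left).1 hqk) with h | h
      · exact hj (X_dvd_eval (isx 2 h j) _ (by simp))
      · exact case0 (hqp.dvd_of_dvd_pow h)

lemma ext3 {f g : Fin 3 → PolyC} (h0 : f 0 = g 0) (h1 : f 1 = g 1) (h2 : f 2 = g 2) : f = g := by
  funext i
  fin_cases i
  · exact h0
  · exact h1
  · exact h2

/-- normal form of the lower triangular orbit of `κ x³ dy + (y³ + e x² y + μ x³) dx` -/
def N1 (κ e μ v s t q p : ℂ) : Fin 3 → PolyC :=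
  mkF ![v, 3 * t * v, (3 * t ^ 2 + e * s ^ 2) * v, v * (t ^ 3 + (e + κ) * s ^ 2 * t + μ * s ^ 3)]
    ![0, 0, 0, v * κ * s ^ 2] ![q, 3 * t * q, (3 * t ^ 2 + e * s ^ 2) * q, p]

/-- normal form of the lower triangular orbit of `κ x³ dx + (y³ + e x² y) dy` -/
def N2 (κ e v s t q p : ℂ) : Fin 3 → PolyC :=
  mkF ![t * v, 3 * t ^ 2 * v, (3 * t ^ 2 + e * s ^ 2) * t * v,
      v * (t ^ 4 + e * s ^ 2 * t ^ 2 + κ * s ^ 4)]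
    ![v, 3 * t * v, (3 * t ^ 2 + e * s ^ 2) * v, v * (t ^ 3 + e * s ^ 2 * t)]
    ![q, 3 * t * q, (3 * t ^ 2 + e * s ^ 2) * q, p]

/-- normal form of the lower triangular orbit of `F₄` -/
def N4 (v s t q p : ℂ) : Fin 3 → PolyC :=
  mkF ![v, 3 * t * v, 3 * t ^ 2 * v, v * (t ^ 3 + s ^ 3)] ![0, 0, 0, 0]
    ![q, 3 * t * q, 3 * t ^ 2 * q, p]

lemma N1_back (κ e μ v s t q p : ℂ) (hκ : κ ≠ 0) (hv : v ≠ 0) (hs : s ≠ 0) :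
    LinConj3 (N1 κ e μ 1 1 0 0 0) (N1 κ e μ v s t q p) := by
  obtain ⟨f, rfl⟩ : ∃ f, v = f * s := ⟨v / s, by field_simp⟩
  obtain ⟨g, rfl⟩ : ∃ g, q = - g * s := ⟨- q / s, by field_simp⟩
  obtain ⟨d, rfl⟩ : ∃ d, p = d * κ * s ^ 3 - g * s * (t ^ 3 + (e + κ) * s ^ 2 * t + μ * s ^ 3) :=
    ⟨(p + g * s * (t ^ 3 + (e + κ) * s ^ 2 * t + μ * s ^ 3)) / (κ * s ^ 3), by field_simp; ring⟩
  refine linConj3_of _ _ !![s, 0, 0; t, 1, 0; d, g, f] 1 ?_ one_ne_zero ?_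
  · simp [Matrix.det_fin_three, hs, left_ne_zero_of_mul hv]
  · apply ext3 <;> simp only [N1, mkF, pb3, subst3, Fin.sum_univ_three, Matrix.of_apply,
      Matrix.cons_val, map_add, map_sub, map_neg, map_mul, map_pow, map_ofNat, map_zero, map_one,
      aeval_X, aeval_C, algebraMap_eq] <;> ring

lemma N2_back (κ e v s t q p : ℂ) (hκ : κ ≠ 0) (hv : v ≠ 0) (hs : s ≠ 0) :
    LinConj3 (N2 κ e 1 1 0 0 0) (N2 κ e v s t q p) := by
  obtain ⟨g, rfl⟩ : ∃ g, p = q * (t ^ 3 + e * s ^ 2 * t) - g * κ * s ^ 4 :=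
    ⟨(q * (t ^ 3 + e * s ^ 2 * t) - p) / (κ * s ^ 4), by field_simp; ring⟩
  refine linConj3_of _ _ !![s, 0, 0; t, 1, 0; q + g * t, g, v] 1 ?_ one_ne_zero ?_
  · simp [Matrix.det_fin_three, hs, hv]
  · apply ext3 <;> simp only [N2, mkF, pb3, subst3, Fin.sum_univ_three, Matrix.of_apply,
      Matrix.cons_val, map_add, map_sub, map_neg, map_mul, map_pow, map_ofNat, map_zero, map_one,
      aeval_X, aeval_C, algebraMap_eq] <;> ring

lemma N4_back (v s t q p : ℂ) (hv : v ≠ 0) (hs : s ≠ 0) (hp : p - q * (t ^ 3 + s ^ 3) ≠ 0) :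
    LinConj3 (N4 1 1 0 0 1) (N4 v s t q p) := by
  obtain ⟨l, hl⟩ : ∃ l, p - q * (t ^ 3 + s ^ 3) = l * s ^ 4 :=
    ⟨(p - q * (t ^ 3 + s ^ 3)) / s ^ 4, by field_simp⟩
  have hl0 : l ≠ 0 := by
    rintro rfl
    simp [hl] at hp
  obtain rfl : p = q * (t ^ 3 + s ^ 3) + l * s ^ 4 := by linear_combination hl
  obtain ⟨f, rfl⟩ : ∃ f, v = l * f * s := ⟨v / (l * s), by field_simp⟩
  obtain ⟨g, rfl⟩ : ∃ g, q = - l * g * s := ⟨- q / (l * s), by field_simp⟩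
  refine linConj3_of _ _ !![s, 0, 0; t, 1, 0; 0, g, f] l ?_ hl0 ?_
  · have := right_ne_zero_of_mul (left_ne_zero_of_mul hv)
    simp [Matrix.det_fin_three, hs, this]
  · apply ext3 <;> simp only [N4, mkF, pb3, subst3, Fin.sum_univ_three, Matrix.of_apply,
      Matrix.cons_val, map_add, map_sub, map_neg, map_mul, map_pow, map_ofNat, map_zero, map_one,
      aeval_X, aeval_C, algebraMap_eq] <;> ring

lemma tri_form (T : Matrix (Fin 3) (Fin 3) ℂ) (h1 : T 0 1 = 0) (h2 : T 0 2 = 0) (h3 : T 1 2 = 0)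
    (hd : T.det ≠ 0) : ∃ s t c d g f : ℂ, s ≠ 0 ∧ c ≠ 0 ∧ f ≠ 0 ∧
      T = !![s * c, 0, 0; t * c, c, 0; d, g, f] := by
  rw [Matrix.det_fin_three, h1, h2, h3] at hd
  have hd' : T 0 0 * T 1 1 * T 2 2 ≠ 0 := by
    intro h
    apply hd
    linear_combination h
  have hf := right_ne_zero_of_mul hd'
  have hc := right_ne_zero_of_mul (left_ne_zero_of_mul hd')
  have ha := left_ne_zero_of_mul (left_ne_zero_of_mul hd')
  refine ⟨T 0 0 / T 1 1, T 1 0 / T 1 1, T 1 1, T 2 0, T 2 1, T 2 2, div_ne_zero ha hc, hc, hf, ?_⟩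
  rw [div_mul_cancel₀ _ hc, div_mul_cancel₀ _ hc]
  conv_lhs => rw [Matrix.eta_fin_three T, h1, h2, h3]

lemma N1_fwd (κ e μ : ℂ) (T : Matrix (Fin 3) (Fin 3) ℂ) (l : ℂ)
    (h : T 0 1 = 0 ∧ T 0 2 = 0 ∧ T 1 2 = 0 ∧ T.det ≠ 0 ∧ l ≠ 0) :
    ∃ v s t q p : ℂ, ∀ i, C l * pb3 T (N1 κ e μ 1 1 0 0 0) i = N1 κ e μ v s t q p i := by
  obtain ⟨h1, h2, h3, hd, hl⟩ := h
  obtain ⟨s, t, c, d, g, f, hs, hc, hf, rfl⟩ := tri_form T h1 h2 h3 hd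
  refine ⟨l * f * c ^ 4 * s, s, t, - (l * g * c ^ 4 * s),
    l * c ^ 4 * s * (d * κ * s ^ 2 - g * (t ^ 3 + (e + κ) * s ^ 2 * t + μ * s ^ 3)), ?_⟩
  refine congrFun (f := fun i => C l * pb3 _ (N1 κ e μ 1 1 0 0 0) i) (ext3 ?_ ?_ ?_) <;>
    simp only [N1, mkF, pb3, subst3, Fin.sum_univ_three, Matrix.of_apply,
      Matrix.cons_val, map_add, map_sub, map_neg, map_mul, map_pow, map_ofNat, map_zero, map_one,
      aeval_X, aeval_C, algebraMap_eq] <;> ring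

lemma N2_fwd (κ e : ℂ) (T : Matrix (Fin 3) (Fin 3) ℂ) (l : ℂ)
    (h : T 0 1 = 0 ∧ T 0 2 = 0 ∧ T 1 2 = 0 ∧ T.det ≠ 0 ∧ l ≠ 0) :
    ∃ v s t q p : ℂ, ∀ i, C l * pb3 T (N2 κ e 1 1 0 0 0) i = N2 κ e v s t q p i := by
  obtain ⟨h1, h2, h3, hd, hl⟩ := h
  obtain ⟨s, t, c, d, g, f, hs, hc, hf, rfl⟩ := tri_form T h1 h2 h3 hd
  refine ⟨l * f * c ^ 4, s, t, l * c ^ 4 * (d - g * t),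
    l * c ^ 4 * (d * (t ^ 3 + e * s ^ 2 * t) - g * (t ^ 4 + e * s ^ 2 * t ^ 2 + κ * s ^ 4)), ?_⟩
  refine congrFun (f := fun i => C l * pb3 _ (N2 κ e 1 1 0 0 0) i) (ext3 ?_ ?_ ?_) <;>
    simp only [N2, mkF, pb3, subst3, Fin.sum_univ_three, Matrix.of_apply,
      Matrix.cons_val, map_add, map_sub, map_neg, map_mul, map_pow, map_ofNat, map_zero, map_one,
      aeval_X, aeval_C, algebraMap_eq] <;> ring

lemma N4_fwd (T : Matrix (Fin 3) (Fin 3) ℂ) (l : ℂ)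
    (h : T 0 1 = 0 ∧ T 0 2 = 0 ∧ T 1 2 = 0 ∧ T.det ≠ 0 ∧ l ≠ 0) :
    ∃ v s t q p : ℂ, ∀ i, C l * pb3 T (N4 1 1 0 0 1) i = N4 v s t q p i := by
  obtain ⟨h1, h2, h3, hd, hl⟩ := h
  obtain ⟨s, t, c, d, g, f, hs, hc, hf, rfl⟩ := tri_form T h1 h2 h3 hd
  refine ⟨l * f * c ^ 4 * s, s, t, - (l * g * c ^ 4 * s),
    l * c ^ 4 * s * (- g * (t ^ 3 + s ^ 3)) + l * c ^ 5 * s ^ 4, ?_⟩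
  refine congrFun (f := fun i => C l * pb3 _ (N4 1 1 0 0 1) i) (ext3 ?_ ?_ ?_) <;>
    simp only [N4, mkF, pb3, subst3, Fin.sum_univ_three, Matrix.of_apply,
      Matrix.cons_val, map_add, map_sub, map_neg, map_mul, map_pow, map_ofNat, map_zero, map_one,
      aeval_X, aeval_C, algebraMap_eq] <;> ring

lemma F1a (b τ q p : ℂ) (hb : b ≠ 0) (hq : q ≠ 0) :
    LinConj3 OmF1 (mkF ![0, 0, 0, b * τ] ![0, 0, 0, b] ![q, 3 * τ * q, 3 * τ ^ 2 * q, p]) := by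
  obtain ⟨f, rfl⟩ : ∃ f, b = - q * f := ⟨- b / q, by field_simp⟩
  obtain ⟨g, rfl⟩ : ∃ g, p = q * τ ^ 3 - q * g := ⟨(q * τ ^ 3 - p) / q, by field_simp; ring⟩
  refine linConj3_of _ _ !![τ, 1, 0; 1, 0, 0; g, 0, f] (-q) ?_ (neg_ne_zero.2 hq) ?_
  · simp [Matrix.det_fin_three, right_ne_zero_of_mul hb]
  · apply ext3 <;> simp only [OmF1, mkF, pb3, subst3, Fin.sum_univ_three, Matrix.of_apply,
      Matrix.cons_val, map_add, map_sub, map_neg, map_mul, map_pow, map_ofNat, map_zero, map_one,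
      aeval_X, aeval_C, algebraMap_eq] <;> ring

lemma F1b (v τ q p : ℂ) (hv : v ≠ 0) (hr : p - q * τ ^ 3 ≠ 0) :
    LinConj3 OmF1 (mkF ![v, 3 * τ * v, 3 * τ ^ 2 * v, v * τ ^ 3] ![0, 0, 0, 0]
      ![q, 3 * τ * q, 3 * τ ^ 2 * q, p]) := by
  obtain ⟨r, hr'⟩ : ∃ r, r = p - q * τ ^ 3 := ⟨_, rfl⟩
  rw [← hr'] at hr
  obtain rfl : p = r + q * τ ^ 3 := by linear_combination -hr'
  obtain ⟨f, rfl⟩ : ∃ f, v = r * f := ⟨v / r, by field_simp⟩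
  obtain ⟨g, rfl⟩ : ∃ g, q = - r * g := ⟨- q / r, by field_simp⟩
  refine linConj3_of _ _ !![1, 0, 0; τ, 1, 0; g * τ, g, f] r ?_ hr ?_
  · simp [Matrix.det_fin_three, right_ne_zero_of_mul hv]
  · apply ext3 <;> simp only [OmF1, mkF, pb3, subst3, Fin.sum_univ_three, Matrix.of_apply,
      Matrix.cons_val, map_add, map_sub, map_neg, map_mul, map_pow, map_ofNat, map_zero, map_one,
      aeval_X, aeval_C, algebraMap_eq] <;> ring

lemma F2a (a τ q p : ℂ) (ha : a ≠ 0) (hq : q ≠ 0) :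
    LinConj3 OmF2 (mkF ![0, 0, 0, a] ![0, 0, 0, 0] ![q, 3 * τ * q, 3 * τ ^ 2 * q, p]) := by
  obtain ⟨f, rfl⟩ : ∃ f, a = q * f := ⟨a / q, by field_simp⟩
  obtain ⟨g, rfl⟩ : ∃ g, p = q * τ ^ 3 - q * g := ⟨(q * τ ^ 3 - p) / q, by field_simp; ring⟩
  refine linConj3_of _ _ !![1, 0, 0; τ, 1, 0; g * τ, g, f] q ?_ hq ?_
  · simp [Matrix.det_fin_three, right_ne_zero_of_mul ha]
  · apply ext3 <;> simp only [OmF2, mkF, pb3, subst3, Fin.sum_univ_three, Matrix.of_apply,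
      Matrix.cons_val, map_add, map_sub, map_neg, map_mul, map_pow, map_ofNat, map_zero, map_one,
      aeval_X, aeval_C, algebraMap_eq] <;> ring

lemma F2b (v τ q p : ℂ) (hv : v ≠ 0) (hr : p - q * τ ^ 3 ≠ 0) :
    LinConj3 OmF2 (mkF ![τ * v, 3 * τ ^ 2 * v, 3 * τ ^ 3 * v, v * τ ^ 4]
      ![v, 3 * τ * v, 3 * τ ^ 2 * v, v * τ ^ 3]
      ![q, 3 * τ * q, 3 * τ ^ 2 * q, p]) := by
  obtain ⟨r, hr'⟩ : ∃ r, r = p - q * τ ^ 3 := ⟨_, rfl⟩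
  rw [← hr'] at hr
  obtain rfl : p = r + q * τ ^ 3 := by linear_combination -hr'
  obtain ⟨f, rfl⟩ : ∃ f, v = - r * f := ⟨- v / r, by field_simp⟩
  obtain ⟨g, rfl⟩ : ∃ g, q = - r * g := ⟨- q / r, by field_simp⟩
  refine linConj3_of _ _ !![τ, 1, 0; 1, 0, 0; g, 0, f] (-r) ?_ (neg_ne_zero.2 hr) ?_
  · simp [Matrix.det_fin_three, right_ne_zero_of_mul hv]
  · apply ext3 <;> simp only [OmF2, mkF, pb3, subst3, Fin.sum_univ_three, Matrix.of_apply,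
      Matrix.cons_val, map_add, map_sub, map_neg, map_mul, map_pow, map_ofNat, map_zero, map_one,
      aeval_X, aeval_C, algebraMap_eq] <;> ring

lemma H1_conj : LinConj3 (N1 (-1) 0 0 1 1 0 0 0) OmH1 := by
  refine linConj3_of _ _ 1 1 (by simp) one_ne_zero ?_
  rw [pb3_one]
  apply ext3 <;> simp only [N1, mkF, OmH1,
      Matrix.cons_val, map_add, map_sub, map_neg, map_mul, map_pow, map_ofNat, map_zero, map_one] <;>
      ring

lemma H2_conj : LinConj3 (N2 (-1) 0 1 1 0 0 0) OmH2 := by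
  refine linConj3_of _ _ 1 (-1) (by simp) (by norm_num) ?_
  rw [pb3_one]
  apply ext3 <;> simp only [N2, mkF, OmH2,
      Matrix.cons_val, map_add, map_sub, map_neg, map_mul, map_pow, map_ofNat, map_zero, map_one] <;>
      ring


lemma H3_conj : LinConj3 (N1 2 (-3) 0 1 1 0 0 0) OmH3 := by
  refine ⟨!![1, 1, 0; 1, -1, 0; 0, 0, 1], 4, ?_, by norm_num, ?_⟩
  · simp [Matrix.det_fin_three] <;> norm_num
  · apply ext3 <;> simp only [N1, N2, mkF, OmH3, pb3, subst3, Fin.sum_univ_three, Matrix.of_apply,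
      Matrix.cons_val, map_add, map_sub, map_neg, map_mul, map_pow, map_ofNat, map_zero, map_one,
      aeval_X, aeval_C, algebraMap_eq] <;> ring

lemma H5_conj : LinConj3 (N1 (-4) (-3) (-6) 1 1 0 0 0) OmH5 := by
  refine ⟨!![0, 1, 0; 2, -1, 0; 0, 0, 1], -4, ?_, by norm_num, ?_⟩
  · simp [Matrix.det_fin_three]
  · apply ext3 <;> simp only [N1, N2, mkF, OmH5, pb3, subst3, Fin.sum_univ_three, Matrix.of_apply,
      Matrix.cons_val, map_add, map_sub, map_neg, map_mul, map_pow, map_ofNat, map_zero, map_one,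
      aeval_X, aeval_C, algebraMap_eq] <;> ring

lemma H8_conj : LinConj3 (N2 (-4) (-3) 1 1 0 0 0) OmH8 := by
  refine ⟨!![0, 1, 0; 1, 0, 0; 0, 0, 1], 1, ?_, by norm_num, ?_⟩
  · simp [Matrix.det_fin_three]
  · apply ext3 <;> simp only [N1, N2, mkF, OmH8, pb3, subst3, Fin.sum_univ_three, Matrix.of_apply,
      Matrix.cons_val, map_add, map_sub, map_neg, map_mul, map_pow, map_ofNat, map_zero, map_one,
      aeval_X, aeval_C, algebraMap_eq] <;> ring

lemma F4_eq : N4 1 1 0 0 1 = OmF4 := by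
  apply ext3 <;> simp only [N4, mkF, OmF4, Matrix.cons_val, map_add, map_sub, map_neg, map_mul, map_pow, map_ofNat, map_zero, map_one,
      aeval_X, aeval_C, algebraMap_eq] <;> ring

lemma F1_eq : mkF ![1, 0, 0, 0] ![0, 0, 0, 0] ![0, 0, 0, 1] = OmF1 := by
  apply ext3 <;> simp only [mkF, OmF1, Matrix.cons_val, map_add, map_sub, map_neg, map_mul, map_pow, map_ofNat, map_zero, map_one,
      aeval_X, aeval_C, algebraMap_eq] <;> ring

lemma F2_eq : mkF ![0, 0, 0, 1] ![0, 0, 0, 0] ![1, 0, 0, 0] = OmF2 := by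
  apply ext3 <;> simp only [mkF, OmF2, Matrix.cons_val, map_add, map_sub, map_neg, map_mul, map_pow, map_ofNat, map_zero, map_one,
      aeval_X, aeval_C, algebraMap_eq] <;> ring

lemma fol_N1 (κ e μ : ℂ) (hκ : κ ≠ 0) : IsFolDeg 3 (N1 κ e μ 1 1 0 0 0) := by
  refine fol_of _ _ _ 1 κ hκ (Or.inr ?_) ⟨0, ?_⟩ fun _ => ?_
  · simp only [mkF, Matrix.cons_val, map_add, map_mul, map_pow, map_ofNat, map_zero, map_one]
    ring
  · simp [mkF]
  · by_contra! h
    have h1 := h 2 1 0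
    have h2 := h 2 1 1
    have h3 := h 2 1 (-1)
    have h4 := h 2 1 2
    simp [mkF] at h1 h2 h3 h4
    have : (6 : ℂ) = 0 := by first | linear_combination -h4 + 2 * h2 + h1 | linear_combination h4 - 2 * h2 + h1
    norm_num at this

lemma fol_N2 (κ e : ℂ) (hκ : κ ≠ 0) : IsFolDeg 3 (N2 κ e 1 1 0 0 0) := by
  refine fol_of _ _ _ 0 κ hκ (Or.inr ?_) ⟨2, ?_⟩ fun _ => ⟨2, 1, 0, ?_⟩
  · simp only [mkF, Matrix.cons_val, map_add, map_mul, map_pow, map_ofNat, map_zero, map_one]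
    ring
  · simp [mkF]
  · simp [mkF, hκ]

lemma fol_N4 : IsFolDeg 3 (N4 1 1 0 0 1) := by
  have h1 : mkF ![1, 3 * 0 * 1, 3 * 0 ^ 2 * 1, 1 * (0 ^ 3 + 1 ^ 3)] ![0, 0, 0, 0]
    ![0, 3 * 0 * 0, 3 * 0 ^ 2 * 0, 1] 1 = C 1 * X 0 ^ 4 := by
    simp only [mkF, Matrix.cons_val, map_add, map_mul, map_pow, map_ofNat, map_zero, map_one]
    ring
  refine fol_of _ _ _ 1 1 one_ne_zero (Or.inl h1) ⟨0, ?_⟩ fun _ => ⟨1, 1, 0, ?_⟩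
  · simp [mkF]
  · rw [h1]; simp

lemma fol_F1 : IsFolDeg 3 OmF1 := by
  rw [← F1_eq]
  have h1 : mkF ![1, 0, 0, 0] ![0, 0, 0, 0] ![0, 0, 0, 1] 1 = C 1 * X 0 ^ 4 := by
    simp only [mkF, Matrix.cons_val, map_add, map_mul, map_pow, map_ofNat, map_zero, map_one]
    ring
  refine fol_of _ _ _ 1 1 one_ne_zero (Or.inl h1) ⟨0, ?_⟩ fun _ => ⟨1, 1, 0, ?_⟩
  · simp [mkF]
  · rw [h1]; simp

lemma fol_F2 : IsFolDeg 3 OmF2 := by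
  rw [← F2_eq]
  have h1 : mkF ![0, 0, 0, 1] ![0, 0, 0, 0] ![1, 0, 0, 0] 2 = C (-1) * X 0 ^ 4 := by
    simp only [mkF, Matrix.cons_val, map_add, map_mul, map_pow, map_ofNat, map_zero, map_one, map_neg]
    ring
  refine fol_of _ _ _ 2 (-1) (by norm_num) (Or.inl h1) ⟨0, ?_⟩ fun _ => ⟨2, 1, 0, ?_⟩
  · simp [mkF]
  · rw [h1]; simp

lemma fol_ker (c : Fin 4 → ℂ) (α β γ : ℂ) (a b p : Fin 4 → ℂ) (ha : ∀ i, a i = α * c i)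
    (hb : ∀ i, b i = β * c i) (hp : ∀ i, p i = γ * c i) (h : IsFolDeg 3 (mkF a b p)) : False := by
  refine fol_const h (C (c 0) * X 1 ^ 3 + C (c 1) * X 0 * X 1 ^ 2 + C (c 2) * X 0 ^ 2 * X 1
        + C (c 3) * X 0 ^ 3) (by simp) ?_
  intro i
  fin_cases i
  · refine ⟨X 2 * C α - X 1 * C γ, ?_⟩
    simp only [mkF, ha, hb, hp, map_mul, Fin.zero_eta, Matrix.cons_val]
    ring
  · refine ⟨X 2 * C β + X 0 * C γ, ?_⟩
    simp only [mkF, ha, hb, hp, map_mul, Fin.mk_one, Matrix.cons_val]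
    ring
  · refine ⟨- (X 0 * C α + X 1 * C β), ?_⟩
    simp only [mkF, ha, hb, hp, map_mul, Fin.reduceFinMk, Matrix.cons_val]
    ring

lemma fol_x (a b p : Fin 4 → ℂ) (ha : a 0 = 0) (hb : b 0 = 0) (h : IsFolDeg 3 (mkF a b p)) :
    p 0 ≠ 0 := by
  intro hp
  refine fol_const h (X 0) (by simp) ?_
  have key : ∀ c : Fin 4 → ℂ, c 0 = 0 → (X 0 : PolyC) ∣ C (c 0) * X 1 ^ 3 + C (c 1) * X 0 * X 1 ^ 2
      + C (c 2) * X 0 ^ 2 * X 1 + C (c 3) * X 0 ^ 3 := by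
    intro c hc
    refine ⟨C (c 1) * X 1 ^ 2 + C (c 2) * X 0 * X 1 + C (c 3) * X 0 ^ 2, ?_⟩
    rw [hc, map_zero]
    ring
  intro i
  fin_cases i
  · exact dvd_sub ((key a ha).mul_left _) ((key p hp).mul_left _)
  · exact dvd_add ((key b hb).mul_left _) ((key p hp).mul_left _)
  · exact (dvd_add ((key a ha).mul_left _) ((key b hb).mul_left _)).neg_right

lemma pow_lim (s : ℕ → ℂ) (k : ℕ) (hk : k ≠ 0) (L : ℂ)
    (h : Tendsto (fun n => s n ^ k) (hyperfilter ℕ : Filter ℕ) (𝓝 L)) :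
    ∃ s0, Tendsto s (hyperfilter ℕ : Filter ℕ) (𝓝 s0) := by
  have h1 : ∀ᶠ n in (hyperfilter ℕ : Filter ℕ), ‖s n ^ k‖ < ‖L‖ + 1 :=
    h.norm.eventually_lt_const (by linarith)
  have h2 : ∀ᶠ n in (hyperfilter ℕ : Filter ℕ), s n ∈ Metric.closedBall (0 : ℂ) (‖L‖ + 1) := by
    filter_upwards [h1] with n hn
    rw [mem_closedBall_zero_iff]
    by_contra! hc
    rw [norm_pow] at hn
    have h3 : 1 ≤ ‖s n‖ := by linarith [norm_nonneg L]
    have := le_self_pow₀ h3 hk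
    linarith
  obtain ⟨x, -, hx⟩ := (isCompact_closedBall (0 : ℂ) (‖L‖ + 1)).ultrafilter_le_nhds
    ((hyperfilter ℕ).map s) (Filter.le_principal_iff.2 h2)
  exact ⟨x, hx⟩

section
variable {f : Filter ℕ} {v s t q p : ℕ → ℂ} {v' s' t' q' p' : ℂ}

lemma five (F : ℂ × ℂ × ℂ × ℂ × ℂ → ℂ) (hF : Continuous F)
    (hv : Tendsto v f (𝓝 v')) (hs : Tendsto s f (𝓝 s')) (ht : Tendsto t f (𝓝 t'))
    (hq : Tendsto q f (𝓝 q')) (hp : Tendsto p f (𝓝 p')) :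
    Tendsto (fun n => F (v n, s n, t n, q n, p n)) f (𝓝 (F (v', s', t', q', p'))) :=
  (hF.tendsto _).comp
    (hv.prodMk_nhds (hs.prodMk_nhds (ht.prodMk_nhds (hq.prodMk_nhds hp))))

lemma N1_cont (κ e μ : ℂ) (hv : Tendsto v f (𝓝 v')) (hs : Tendsto s f (𝓝 s')) (ht : Tendsto t f (𝓝 t'))
    (hq : Tendsto q f (𝓝 q')) (hp : Tendsto p f (𝓝 p')) (i : Fin 3) :
    TC f (fun n => N1 κ e μ (v n) (s n) (t n) (q n) (p n) i) (N1 κ e μ v' s' t' q' p' i) := by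
  refine TC_mk (fun i => ?_) (fun i => ?_) (fun i => ?_) i
  · exact five (fun x => (![x.1, 3 * x.2.2.1 * x.1, (3 * x.2.2.1 ^ 2 + e * x.2.1 ^ 2) * x.1,
      x.1 * (x.2.2.1 ^ 3 + (e + κ) * x.2.1 ^ 2 * x.2.2.1 + μ * x.2.1 ^ 3)] : Fin 4 → ℂ) i)
      (by fin_cases i <;> simp <;> fun_prop) hv hs ht hq hp
  · exact five (fun x => (![0, 0, 0, x.1 * κ * x.2.1 ^ 2] : Fin 4 → ℂ) i)
      (by fin_cases i <;> simp <;> fun_prop) hv hs ht hq hp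
  · exact five (fun x => (![x.2.2.2.1, 3 * x.2.2.1 * x.2.2.2.1,
      (3 * x.2.2.1 ^ 2 + e * x.2.1 ^ 2) * x.2.2.2.1, x.2.2.2.2] : Fin 4 → ℂ) i)
      (by fin_cases i <;> simp <;> fun_prop) hv hs ht hq hp

lemma N2_cont (κ e : ℂ) (hv : Tendsto v f (𝓝 v')) (hs : Tendsto s f (𝓝 s')) (ht : Tendsto t f (𝓝 t'))
    (hq : Tendsto q f (𝓝 q')) (hp : Tendsto p f (𝓝 p')) (i : Fin 3) :
    TC f (fun n => N2 κ e (v n) (s n) (t n) (q n) (p n) i) (N2 κ e v' s' t' q' p' i) := by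
  refine TC_mk (fun i => ?_) (fun i => ?_) (fun i => ?_) i
  · exact five (fun x => (![x.2.2.1 * x.1, 3 * x.2.2.1 ^ 2 * x.1,
      (3 * x.2.2.1 ^ 2 + e * x.2.1 ^ 2) * x.2.2.1 * x.1,
      x.1 * (x.2.2.1 ^ 4 + e * x.2.1 ^ 2 * x.2.2.1 ^ 2 + κ * x.2.1 ^ 4)] : Fin 4 → ℂ) i)
      (by fin_cases i <;> simp <;> fun_prop) hv hs ht hq hp
  · exact five (fun x => (![x.1, 3 * x.2.2.1 * x.1, (3 * x.2.2.1 ^ 2 + e * x.2.1 ^ 2) * x.1,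
      x.1 * (x.2.2.1 ^ 3 + e * x.2.1 ^ 2 * x.2.2.1)] : Fin 4 → ℂ) i)
      (by fin_cases i <;> simp <;> fun_prop) hv hs ht hq hp
  · exact five (fun x => (![x.2.2.2.1, 3 * x.2.2.1 * x.2.2.2.1,
      (3 * x.2.2.1 ^ 2 + e * x.2.1 ^ 2) * x.2.2.2.1, x.2.2.2.2] : Fin 4 → ℂ) i)
      (by fin_cases i <;> simp <;> fun_prop) hv hs ht hq hp

lemma N4_cont (hv : Tendsto v f (𝓝 v')) (hs : Tendsto s f (𝓝 s')) (ht : Tendsto t f (𝓝 t'))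
    (hq : Tendsto q f (𝓝 q')) (hp : Tendsto p f (𝓝 p')) (i : Fin 3) :
    TC f (fun n => N4 (v n) (s n) (t n) (q n) (p n) i) (N4 v' s' t' q' p' i) := by
  refine TC_mk (fun i => ?_) (fun i => ?_) (fun i => ?_) i
  · exact five (fun x => (![x.1, 3 * x.2.2.1 * x.1, 3 * x.2.2.1 ^ 2 * x.1,
      x.1 * (x.2.2.1 ^ 3 + x.2.1 ^ 3)] : Fin 4 → ℂ) i)
      (by fin_cases i <;> simp <;> fun_prop) hv hs ht hq hp
  · exact five (fun x => (![0, 0, 0, 0] : Fin 4 → ℂ) i)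
      (by fin_cases i <;> simp <;> fun_prop) hv hs ht hq hp
  · exact five (fun x => (![x.2.2.2.1, 3 * x.2.2.1 * x.2.2.2.1,
      3 * x.2.2.1 ^ 2 * x.2.2.2.1, x.2.2.2.2] : Fin 4 → ℂ) i)
      (by fin_cases i <;> simp <;> fun_prop) hv hs ht hq hp
end

lemma lim_quot {t v : ℕ → ℂ} {L L0 : ℂ} (h : Tendsto (fun n => t n * v n) (hyperfilter ℕ : Filter ℕ) (𝓝 L))
    (h0 : Tendsto v (hyperfilter ℕ : Filter ℕ) (𝓝 L0)) (hL : L0 ≠ 0) :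
    Tendsto t (hyperfilter ℕ : Filter ℕ) (𝓝 (L / L0)) := by
  refine (h.div h0 hL).congr' ?_
  filter_upwards [h0.eventually_ne hL] with n hn
  simp only [Pi.div_apply]
  field_simp

lemma lim_quot3 {t v : ℕ → ℂ} {L L0 : ℂ}
    (h : Tendsto (fun n => 3 * t n * v n) (hyperfilter ℕ : Filter ℕ) (𝓝 L))
    (h0 : Tendsto v (hyperfilter ℕ : Filter ℕ) (𝓝 L0)) (hL : L0 ≠ 0) :
    ∃ τ, Tendsto t (hyperfilter ℕ : Filter ℕ) (𝓝 τ) := by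
  refine ⟨1 / 3 * (L / L0), ((lim_quot h h0 hL).const_mul (1 / 3)).congr fun n => ?_⟩
  ring

lemma vec4 {a : Fin 4 → ℂ} {x y z w : ℂ} (h0 : a 0 = x) (h1 : a 1 = y) (h2 : a 2 = z) (h3 : a 3 = w) :
    a = ![x, y, z, w] := by
  funext i
  fin_cases i
  · exact h0
  · exact h1
  · exact h2
  · exact h3

lemma N1_lim (κ e μ : ℂ) (hκ : κ ≠ 0) (he : e = 0 → μ = 0) (v s t q p : ℕ → ℂ) (Y : Fin 3 → PolyC)
    (hY : IsFolDeg 3 Y) (h : ∀ i, TC (hyperfilter ℕ : Filter ℕ)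
      (fun n => N1 κ e μ (v n) (s n) (t n) (q n) (p n) i) (Y i)) :
    LinConj3 OmF1 Y ∨ LinConj3 (N1 κ e μ 1 1 0 0 0) Y := by
  obtain ⟨a, b, c, rfl, ha, hb, hc⟩ := mk_lim h
  have a0 := ha 0
  have a1 := ha 1
  have a2 := ha 2
  have a3 := ha 3
  have b0 := hb 0
  have b1 := hb 1
  have b2 := hb 2
  have b3 := hb 3
  have c0 := hc 0
  have c1 := hc 1
  have c2 := hc 2
  have c3 := hc 3
  simp only [Matrix.cons_val] at a0 a1 a2 a3 b0 b1 b2 b3 c0 c1 c2 c3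
  have eb0 : b 0 = 0 := tendsto_nhds_unique b0 tendsto_const_nhds
  have eb1 : b 1 = 0 := tendsto_nhds_unique b1 tendsto_const_nhds
  have eb2 : b 2 = 0 := tendsto_nhds_unique b2 tendsto_const_nhds
  by_cases h0 : a 0 = 0
  · have hc0 := fol_x _ _ _ h0 eb0 hY
    obtain ⟨τ, ht⟩ := lim_quot3 c1 c0 hc0
    rw [h0] at a0
    by_cases hez : e = 0
    · obtain rfl := he hez
      subst hez
      have ea1 : a 1 = 0 := tendsto_nhds_unique a1 (by simpa using (ht.const_mul 3).mul a0)
      have ea2 : a 2 = 0 := tendsto_nhds_unique a2 (by simpa using ((ht.pow 2).const_mul 3).mul a0)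
      have ea3 : a 3 = b 3 * τ := tendsto_nhds_unique a3 (by
        have := (a0.mul (ht.pow 3)).add (b3.mul ht)
        rw [zero_mul, zero_add] at this
        exact this.congr fun n => by ring)
      have ec1 : c 1 = 3 * τ * c 0 := tendsto_nhds_unique c1 ((ht.const_mul 3).mul c0)
      have ec2 : c 2 = 3 * τ ^ 2 * c 0 := tendsto_nhds_unique c2
        ((((ht.pow 2).const_mul 3).mul c0).congr fun n => by ring)
      have hb3 : b 3 ≠ 0 := by
        intro hb3
        rw [hb3, zero_mul] at ea3
        refine fol_ker c 0 0 1 a b c ?_ ?_ (by simp) hY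
        · intro i; fin_cases i <;> simp [*]
        · intro i; fin_cases i <;> simp [*]
      left
      rw [vec4 h0 ea1 ea2 ea3, vec4 eb0 eb1 eb2 rfl, vec4 rfl ec1 ec2 rfl]
      exact F1a _ _ _ _ hb3 hc0
    · exfalso
      have := (((lim_quot c2 c0 hc0).sub ((ht.pow 2).const_mul 3)).const_mul (1 / e)).congr
        (f₂ := fun n => s n ^ 2) (fun n => by field_simp; ring)
      obtain ⟨s0, hs⟩ := pow_lim _ _ two_ne_zero _ this
      have hE : mkF a b c = N1 κ e μ 0 s0 τ (c 0) (c 3) := by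
        funext i
        exact (h i).unique (N1_cont κ e μ a0 hs ht c0 c3 i)
      rw [hE] at hY
      refine fol_ker _ 0 0 1 _ _ _ ?_ ?_ (fun i => (one_mul _).symm) hY
      · intro i; fin_cases i <;> simp
      · intro i; fin_cases i <;> simp
  · obtain ⟨τ, ht⟩ := lim_quot3 a1 a0 h0
    have := ((lim_quot (t := fun n => κ * s n ^ 2) (b3.congr fun n => by ring) a0 h0).const_mul (1 / κ)).congr
        (f₂ := fun n => s n ^ 2) (fun n => by field_simp)
    obtain ⟨s0, hs⟩ := pow_lim _ _ two_ne_zero _ this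
    have hE : mkF a b c = N1 κ e μ (a 0) s0 τ (c 0) (c 3) := by
      funext i
      exact (h i).unique (N1_cont κ e μ a0 hs ht c0 c3 i)
    rw [hE] at hY ⊢
    by_cases hs0 : s0 = 0
    · subst hs0
      have hN : N1 κ e μ (a 0) 0 τ (c 0) (c 3) = mkF ![a 0, 3 * τ * a 0, 3 * τ ^ 2 * a 0, a 0 * τ ^ 3]
          ![0, 0, 0, 0] ![c 0, 3 * τ * c 0, 3 * τ ^ 2 * c 0, c 3] := by simp [N1]
      rw [hN] at hY ⊢
      refine Or.inl (F1b _ _ _ _ h0 fun hr => ?_)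
      have hr' : c 3 = c 0 * τ ^ 3 := by linear_combination hr
      refine fol_ker ![1, 3 * τ, 3 * τ ^ 2, τ ^ 3] (a 0) 0 (c 0) _ _ _ ?_ ?_ ?_ hY
      · intro i; fin_cases i <;> simp <;> ring
      · intro i; fin_cases i <;> simp
      · intro i; fin_cases i <;> simp [hr'] <;> ring
    · exact Or.inr (N1_back _ _ _ _ _ _ _ _ hκ h0 hs0)

lemma N2_lim (κ e : ℂ) (hκ : κ ≠ 0) (v s t q p : ℕ → ℂ) (Y : Fin 3 → PolyC)
    (hY : IsFolDeg 3 Y) (h : ∀ i, TC (hyperfilter ℕ : Filter ℕ)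
      (fun n => N2 κ e (v n) (s n) (t n) (q n) (p n) i) (Y i)) :
    LinConj3 OmF2 Y ∨ LinConj3 (N2 κ e 1 1 0 0 0) Y := by
  obtain ⟨a, b, c, rfl, ha, hb, hc⟩ := mk_lim h
  have a0 := ha 0
  have a1 := ha 1
  have a2 := ha 2
  have a3 := ha 3
  have b0 := hb 0
  have b1 := hb 1
  have b2 := hb 2
  have b3 := hb 3
  have c0 := hc 0
  have c1 := hc 1
  have c2 := hc 2
  have c3 := hc 3
  simp only [Matrix.cons_val] at a0 a1 a2 a3 b0 b1 b2 b3 c0 c1 c2 c3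
  by_cases h0 : b 0 = 0
  · rw [h0] at b0
    have ea0 : a 0 = 0 := by
      have h1 := (a0.pow 2).const_mul 3
      have h2 := b0.mul a1
      rw [zero_mul] at h2
      have := tendsto_nhds_unique (h2.congr fun n => by ring) h1
      simpa using this.symm
    have hc0 := fol_x _ _ _ ea0 h0 hY
    obtain ⟨τ, ht⟩ := lim_quot3 c1 c0 hc0
    by_cases hez : e = 0
    · subst hez
      have ea1 : a 1 = 0 := tendsto_nhds_unique a1 (by simpa using ((ht.pow 2).const_mul 3).mul b0)
      have ea2 : a 2 = 0 := tendsto_nhds_unique a2 (by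
        simpa using (((ht.pow 2).const_mul 3).mul ht).mul b0)
      have eb1 : b 1 = 0 := tendsto_nhds_unique b1 (by simpa using (ht.const_mul 3).mul b0)
      have eb2 : b 2 = 0 := tendsto_nhds_unique b2 (by simpa using ((ht.pow 2).const_mul 3).mul b0)
      have eb3 : b 3 = 0 := tendsto_nhds_unique b3 (by simpa using b0.mul (ht.pow 3))
      have ec1 : c 1 = 3 * τ * c 0 := tendsto_nhds_unique c1 ((ht.const_mul 3).mul c0)
      have ec2 : c 2 = 3 * τ ^ 2 * c 0 := tendsto_nhds_unique c2
        ((((ht.pow 2).const_mul 3).mul c0).congr fun n => by ring)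
      have ha3 : a 3 ≠ 0 := by
        intro ha3
        refine fol_ker c 0 0 1 a b c ?_ ?_ (by simp) hY
        · intro i; fin_cases i <;> simp [*]
        · intro i; fin_cases i <;> simp [*]
      left
      rw [vec4 ea0 ea1 ea2 rfl, vec4 h0 eb1 eb2 eb3, vec4 rfl ec1 ec2 rfl]
      exact F2a _ _ _ _ ha3 hc0
    · exfalso
      have := (((lim_quot c2 c0 hc0).sub ((ht.pow 2).const_mul 3)).const_mul (1 / e)).congr
        (f₂ := fun n => s n ^ 2) (fun n => by field_simp; ring)
      obtain ⟨s0, hs⟩ := pow_lim _ _ two_ne_zero _ this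
      have hE : mkF a b c = N2 κ e 0 s0 τ (c 0) (c 3) := by
        funext i
        exact (h i).unique (N2_cont κ e b0 hs ht c0 c3 i)
      rw [hE] at hY
      refine fol_ker _ 0 0 1 _ _ _ ?_ ?_ (fun i => (one_mul _).symm) hY
      · intro i; fin_cases i <;> simp
      · intro i; fin_cases i <;> simp
  · have ht := lim_quot a0 b0 h0
    generalize a 0 / b 0 = τ at ht
    have := ((lim_quot (t := fun n => κ * s n ^ 4) ((a3.sub (ht.mul b3)).congr fun n => by ring)
      b0 h0).const_mul (1 / κ)).congr
        (f₂ := fun n => s n ^ 4) (fun n => by field_simp)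
    obtain ⟨s0, hs⟩ := pow_lim _ _ four_ne_zero _ this
    have hE : mkF a b c = N2 κ e (b 0) s0 τ (c 0) (c 3) := by
      funext i
      exact (h i).unique (N2_cont κ e b0 hs ht c0 c3 i)
    rw [hE] at hY ⊢
    by_cases hs0 : s0 = 0
    · subst hs0
      have hN : N2 κ e (b 0) 0 τ (c 0) (c 3) =
          mkF ![τ * b 0, 3 * τ ^ 2 * b 0, 3 * τ ^ 3 * b 0, b 0 * τ ^ 4]
          ![b 0, 3 * τ * b 0, 3 * τ ^ 2 * b 0, b 0 * τ ^ 3]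
          ![c 0, 3 * τ * c 0, 3 * τ ^ 2 * c 0, c 3] := by
        have : 3 * τ ^ 2 * τ = 3 * τ ^ 3 := by ring
        simp [N2, this]
      rw [hN] at hY ⊢
      refine Or.inl (F2b _ _ _ _ h0 fun hr => ?_)
      have hr' : c 3 = c 0 * τ ^ 3 := by linear_combination hr
      refine fol_ker ![1, 3 * τ, 3 * τ ^ 2, τ ^ 3] (τ * b 0) (b 0) (c 0) _ _ _ ?_ ?_ ?_ hY
      · intro i; fin_cases i <;> simp <;> ring
      · intro i; fin_cases i <;> simp <;> ring
      · intro i; fin_cases i <;> simp [hr'] <;> ring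
    · exact Or.inr (N2_back _ _ _ _ _ _ _ hκ h0 hs0)

lemma N4_lim (v s t q p : ℕ → ℂ) (Y : Fin 3 → PolyC)
    (hY : IsFolDeg 3 Y) (h : ∀ i, TC (hyperfilter ℕ : Filter ℕ)
      (fun n => N4 (v n) (s n) (t n) (q n) (p n) i) (Y i)) :
    (LinConj3 OmF1 Y ∨ LinConj3 OmF2 Y) ∨ LinConj3 (N4 1 1 0 0 1) Y := by
  obtain ⟨a, b, c, rfl, ha, hb, hc⟩ := mk_lim h
  have a0 := ha 0
  have a1 := ha 1
  have a2 := ha 2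
  have a3 := ha 3
  have b0 := hb 0
  have b1 := hb 1
  have b2 := hb 2
  have b3 := hb 3
  have c0 := hc 0
  have c1 := hc 1
  have c2 := hc 2
  have c3 := hc 3
  simp only [Matrix.cons_val] at a0 a1 a2 a3 b0 b1 b2 b3 c0 c1 c2 c3
  have eb0 : b 0 = 0 := tendsto_nhds_unique b0 tendsto_const_nhds
  have eb1 : b 1 = 0 := tendsto_nhds_unique b1 tendsto_const_nhds
  have eb2 : b 2 = 0 := tendsto_nhds_unique b2 tendsto_const_nhds
  have eb3 : b 3 = 0 := tendsto_nhds_unique b3 tendsto_const_nhds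
  by_cases h0 : a 0 = 0
  · have hc0 := fol_x _ _ _ h0 eb0 hY
    obtain ⟨τ, ht⟩ := lim_quot3 c1 c0 hc0
    rw [h0] at a0
    have ea1 : a 1 = 0 := tendsto_nhds_unique a1 (by simpa using (ht.const_mul 3).mul a0)
    have ea2 : a 2 = 0 := tendsto_nhds_unique a2 (by simpa using ((ht.pow 2).const_mul 3).mul a0)
    have ec1 : c 1 = 3 * τ * c 0 := tendsto_nhds_unique c1 ((ht.const_mul 3).mul c0)
    have ec2 : c 2 = 3 * τ ^ 2 * c 0 := tendsto_nhds_unique c2 (((ht.pow 2).const_mul 3).mul c0)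
    have ha3 : a 3 ≠ 0 := by
      intro ha3
      refine fol_ker c 0 0 1 a b c ?_ ?_ (by simp) hY
      · intro i; fin_cases i <;> simp [*]
      · intro i; fin_cases i <;> simp [*]
    left; right
    rw [vec4 h0 ea1 ea2 rfl, vec4 eb0 eb1 eb2 eb3, vec4 rfl ec1 ec2 rfl]
    exact F2a _ _ _ _ ha3 hc0
  · obtain ⟨τ, ht⟩ := lim_quot3 a1 a0 h0
    have := ((lim_quot (t := fun n => t n ^ 3 + s n ^ 3) (a3.congr fun n => by ring) a0 h0).sub
        (ht.pow 3)).congr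
        (f₂ := fun n => s n ^ 3) (fun n => by ring)
    obtain ⟨s0, hs⟩ := pow_lim _ _ three_ne_zero _ this
    have hE : mkF a b c = N4 (a 0) s0 τ (c 0) (c 3) := by
      funext i
      exact (h i).unique (N4_cont a0 hs ht c0 c3 i)
    rw [hE] at hY ⊢
    have hr : c 3 - c 0 * (τ ^ 3 + s0 ^ 3) ≠ 0 := by
      intro hr
      have hr' : c 3 = c 0 * (τ ^ 3 + s0 ^ 3) := by linear_combination hr
      rw [hr'] at hY
      refine fol_ker ![1, 3 * τ, 3 * τ ^ 2, τ ^ 3 + s0 ^ 3] (a 0) 0 (c 0) _ _ _ ?_ ?_ ?_ hY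
      · intro i; fin_cases i <;> simp <;> ring
      · intro i; fin_cases i <;> simp
      · intro i; fin_cases i <;> simp <;> ring
    by_cases hs0 : s0 = 0
    · subst hs0
      have hN : N4 (a 0) 0 τ (c 0) (c 3) = mkF ![a 0, 3 * τ * a 0, 3 * τ ^ 2 * a 0, a 0 * τ ^ 3]
          ![0, 0, 0, 0] ![c 0, 3 * τ * c 0, 3 * τ ^ 2 * c 0, c 3] := by simp [N4]
      rw [hN]
      refine Or.inl (Or.inl (F1b _ _ _ _ h0 (by simpa using hr)))
    · exact Or.inr (N4_back _ _ _ _ _ h0 hs0 hr)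

lemma inv_lim : Tendsto (fun n : ℕ => 1 / ((n : ℂ) + 1)) atTop (𝓝 0) :=
  tendsto_one_div_add_atTop_nhds_zero_nat

lemma npos (n : ℕ) : (n : ℂ) + 1 ≠ 0 := Nat.cast_add_one_ne_zero n

lemma N1_main (κ e μ : ℂ) (hκ : κ ≠ 0) (he : e = 0 → μ = 0) :
    FClos 3 (OrbitOf (N1 κ e μ 1 1 0 0 0)) = OrbitOf OmF1 ∪ OrbitOf (N1 κ e μ 1 1 0 0 0) := by
  have hf := fol_N1 κ e μ hκ
  apply Set.Subset.antisymm
  · intro Z hZ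
    obtain ⟨Y, hYZ, hY, T, l, hT, hl⟩ := reduce hf hZ
    choose v s t q p hp using fun n => N1_fwd κ e μ (T n) (l n) (hT n)
    have := N1_lim κ e μ hκ he v s t q p Y hY (fun i => by
      have := hl i
      simp only [hp] at this
      exact this)
    exact this.imp (fun h => h.trans' hYZ) (fun h => h.trans' hYZ)
  · refine Set.union_subset ?_ (orbit_subset_FClos hf)
    refine orbit_subset_FClos' hf fol_F1 (fun n => N1 κ e μ 1 (1 / ((n : ℂ) + 1)) 0 0 1)
      (fun n => N1_back _ _ _ _ _ _ _ _ hκ one_ne_zero (one_div_ne_zero (npos n))) fun i => ?_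
    have h1 : OmF1 = N1 κ e μ 1 0 0 0 1 := by rw [← F1_eq]; simp [N1]
    rw [h1]
    exact N1_cont κ e μ tendsto_const_nhds inv_lim tendsto_const_nhds tendsto_const_nhds
      tendsto_const_nhds i

lemma N2_main (κ e : ℂ) (hκ : κ ≠ 0) :
    FClos 3 (OrbitOf (N2 κ e 1 1 0 0 0)) = OrbitOf OmF2 ∪ OrbitOf (N2 κ e 1 1 0 0 0) := by
  have hf := fol_N2 κ e hκ
  apply Set.Subset.antisymm
  · intro Z hZ
    obtain ⟨Y, hYZ, hY, T, l, hT, hl⟩ := reduce hf hZ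
    choose v s t q p hp using fun n => N2_fwd κ e (T n) (l n) (hT n)
    have := N2_lim κ e hκ v s t q p Y hY (fun i => by
      have := hl i
      simp only [hp] at this
      exact this)
    exact this.imp (fun h => h.trans' hYZ) (fun h => h.trans' hYZ)
  · refine Set.union_subset ?_ (orbit_subset_FClos hf)
    have h1 : LinConj3 OmF2 (N2 κ e 1 0 0 0 1) := by
      have := F2b 1 0 0 1 one_ne_zero (by simp)
      convert this using 1
      simp [N2]
    rw [orbit_congr h1]
    refine orbit_subset_FClos' hf (isFol_orbit fol_F2 h1) (fun n => N2 κ e 1 (1 / ((n : ℂ) + 1)) 0 0 1)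
      (fun n => N2_back _ _ _ _ _ _ _ hκ one_ne_zero (one_div_ne_zero (npos n))) fun i => ?_
    exact N2_cont κ e tendsto_const_nhds inv_lim tendsto_const_nhds tendsto_const_nhds
      tendsto_const_nhds i

lemma N4_main : FClos 3 (OrbitOf (N4 1 1 0 0 1)) =
    OrbitOf OmF1 ∪ OrbitOf OmF2 ∪ OrbitOf (N4 1 1 0 0 1) := by
  have hf := fol_N4
  apply Set.Subset.antisymm
  · intro Z hZ
    obtain ⟨Y, hYZ, hY, T, l, hT, hl⟩ := reduce hf hZ
    choose v s t q p hp using fun n => N4_fwd (T n) (l n) (hT n)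
    have := N4_lim v s t q p Y hY (fun i => by
      have := hl i
      simp only [hp] at this
      exact this)
    exact this.imp (fun h => h.imp (fun h => h.trans' hYZ) (fun h => h.trans' hYZ))
      (fun h => h.trans' hYZ)
  · refine Set.union_subset (Set.union_subset ?_ ?_) (orbit_subset_FClos hf)
    · refine orbit_subset_FClos' hf fol_F1 (fun n => N4 1 (1 / ((n : ℂ) + 1)) 0 0 1)
        (fun n => N4_back _ _ _ _ _ one_ne_zero (one_div_ne_zero (npos n)) (by simp)) fun i => ?_
      have h1 : OmF1 = N4 1 0 0 0 1 := by rw [← F1_eq]; simp [N4]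
      rw [h1]
      exact N4_cont tendsto_const_nhds inv_lim tendsto_const_nhds tendsto_const_nhds
        tendsto_const_nhds i
    · refine orbit_subset_FClos' hf fol_F2
        (fun n => N4 ((1 / ((n : ℂ) + 1)) ^ 3) ((n : ℂ) + 1) 0 1 0)
        (fun n => N4_back _ _ _ _ _ (pow_ne_zero _ (one_div_ne_zero (npos n))) (npos n)
          (by simpa using npos n)) fun i => ?_
      have h2 : ∀ n : ℕ, N4 ((1 / ((n : ℂ) + 1)) ^ 3) ((n : ℂ) + 1) 0 1 0 =
          mkF ![(1 / ((n : ℂ) + 1)) ^ 3, 0, 0, 1] ![0, 0, 0, 0] ![1, 0, 0, 0] := by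
        intro n
        have : (1 / ((n : ℂ) + 1)) ^ 3 * (0 ^ 3 + ((n : ℂ) + 1) ^ 3) = 1 := by
          have := npos n
          field_simp
          ring
        rw [N4, this]
        simp
      simp only [h2]
      rw [← F2_eq]
      refine TC_mk (a := fun n : ℕ => ![(1 / ((n : ℂ) + 1)) ^ 3, 0, 0, 1])
        (b := fun _ => ![0, 0, 0, 0]) (p := fun _ => ![1, 0, 0, 0])
        (fun i => ?_) (fun i => tendsto_const_nhds) (fun i => tendsto_const_nhds) i
      fin_cases i
      · have h3 := inv_lim.pow 3
        rw [zero_pow three_ne_zero] at h3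
        exact h3
      · exact tendsto_const_nhds
      · exact tendsto_const_nhds
      · exact tendsto_const_nhds

/-- **Orbit-closure equalities in `F(3)`.**
The closures (taken in `F(3)`) of the orbits of `H₁, H₃, H₅, H₂, H₈, F₄` are as
follows:
`closure O(H₁) = O(F₁) ∪ O(H₁)`, `closure O(H₃) = O(F₁) ∪ O(H₃)`,
`closure O(H₅) = O(F₁) ∪ O(H₅)`, `closure O(H₂) = O(F₂) ∪ O(H₂)`,
`closure O(H₈) = O(F₂) ∪ O(H₈)`, `closure O(F₄) = O(F₁) ∪ O(F₂) ∪ O(F₄)`. -/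
theorem stmt_19 :
    FClos 3 (OrbitOf OmH1) = OrbitOf OmF1 ∪ OrbitOf OmH1 ∧
    FClos 3 (OrbitOf OmH3) = OrbitOf OmF1 ∪ OrbitOf OmH3 ∧
    FClos 3 (OrbitOf OmH5) = OrbitOf OmF1 ∪ OrbitOf OmH5 ∧
    FClos 3 (OrbitOf OmH2) = OrbitOf OmF2 ∪ OrbitOf OmH2 ∧
    FClos 3 (OrbitOf OmH8) = OrbitOf OmF2 ∪ OrbitOf OmH8 ∧
    FClos 3 (OrbitOf OmF4) = OrbitOf OmF1 ∪ OrbitOf OmF2 ∪ OrbitOf OmF4 := by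
  refine ⟨?_, ?_, ?_, ?_, ?_, ?_⟩
  · rw [← orbit_congr H1_conj]
    exact N1_main _ _ _ (by norm_num) (by simp)
  · rw [← orbit_congr H3_conj]
    exact N1_main _ _ _ (by norm_num) (by simp)
  · rw [← orbit_congr H5_conj]
    exact N1_main _ _ _ (by norm_num) (by simp)
  · rw [← orbit_congr H2_conj]
    exact N2_main _ _ (by norm_num)
  · rw [← orbit_congr H8_conj]
    exact N2_main _ _ (by norm_num)
  · rw [← F4_eq]
    exact N4_main
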